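/- arXiv:2306.01133 — 3 statements merged into one kernel-verified Lean document; each statement's English description precedes it below -/
import Mathlib

section
/- The Mishchenko–Fomenko-type index is well defined: if F ∈ B(A) admits two decompositions A = M₁ ⊕̃ N₁ → M₂ ⊕̃ N₂ = A and A = M₁′ ⊕̃ N₁′ → M₂′ ⊕̃ N₂′ = A, each making F diagonal diag(F₁, F₄) with F₁ an isomorphism, and with P_{N₁}, P_{N₂}, P_{N₁′}, P_{N₂′} ∈ F (the ideal of finite type elements), then [P_{N₁}] − [P_{N₂}] = [P_{N₁′}] − [P_{N₂′}] in K(F). -/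
/-!
Common setup: a unital C*-algebra `A` viewed as a right Hilbert module over itself
(with inner product `⟪a,b⟫ = a* b`).  Bounded adjointable operators `B(A)` are
identified with `A` itself acting by left multiplication.
-/

section Defs

variable {A : Type*} [CStarAlgebra A]

/-- A projection (self-adjoint idempotent). -/
def IsProjn (p : A) : Prop := IsSelfAdjoint p ∧ p * p = p

/-- Murray–von Neumann equivalence: `p ∼ q` iff `∃ v, v v* = q ∧ v* v = p`. -/
def MvN (p q : A) : Prop := ∃ v : A, v * star v = q ∧ star v * v = p

/-- `a` is invertible up to the pair of projections `(p, q)` (Kečkić–Lazović). -/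
def InvUpTo (a p q : A) : Prop :=
  ∃ b : A, (1 - q) * a * (1 - p) * b = 1 - q ∧ b * ((1 - q) * a * (1 - p)) = 1 - p

/-- A closed (right) submodule of `A` as a Hilbert module over itself. -/
def IsClosedSubmodule (S : Set A) : Prop :=
  IsClosed S ∧ (0 : A) ∈ S ∧ (∀ x ∈ S, ∀ y ∈ S, x + y ∈ S) ∧
    (∀ x ∈ S, ∀ a : A, x * a ∈ S) ∧ (∀ x ∈ S, -x ∈ S) ∧ (∀ x ∈ S, ∀ c : ℂ, c • x ∈ S)

/-- Orthogonal complement with respect to `⟪a,b⟫ = a* b`. -/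
def orthC (S : Set A) : Set A := {x : A | ∀ y ∈ S, star y * x = 0}

/-- `S` is orthogonally complementable in `A`: `A = S ⊕ S^⊥`. -/
def OrthComplementable (S : Set A) : Prop :=
  ∀ x : A, ∃ n ∈ S, ∃ m ∈ orthC S, x = n + m

/-- `p` is the orthogonal projection onto the submodule `S` (so `S = Im p`). -/
def IsOrthProjOnto (p : A) (S : Set A) : Prop :=
  IsSelfAdjoint p ∧ p * p = p ∧ S = {x : A | p * x = x}

/-- `A = M ⊕̃ N`: direct (not necessarily orthogonal) sum decomposition. -/
def IsComplPair (M N : Set A) : Prop :=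
  (M ∩ N ⊆ {0}) ∧ ∀ x : A, ∃ m ∈ M, ∃ n ∈ N, x = m + n

/-- Image of a submodule under the operator of left multiplication by `F`. -/
def imageOf (F : A) (S : Set A) : Set A := {y : A | ∃ x ∈ S, y = F * x}

/-- The restriction of (left multiplication by) `F` to `M` is an isomorphism onto `M'`:
it maps `M` onto `M'` and is bounded below (hence bicontinuous onto `M'`). -/
def IsIsoOn (F : A) (M M' : Set A) : Prop :=
  (∀ x ∈ M, F * x ∈ M') ∧ (∀ y ∈ M', ∃ x ∈ M, F * x = y) ∧
    ∃ c > (0 : ℝ), ∀ x ∈ M, c * ‖x‖ ≤ ‖F * x‖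

/-- Isomorphism of Hilbert submodules: a bicontinuous `A`-linear bijection `M → N`. -/
def SubmoduleIso (M N : Set A) : Prop :=
  ∃ f : A → A, (∀ x y : A, f (x + y) = f x + f y) ∧ (∀ x a : A, f (x * a) = f x * a) ∧
    (∀ x ∈ M, f x ∈ N) ∧ (∀ y ∈ N, ∃ x ∈ M, f x = y) ∧
    (∃ C > (0 : ℝ), ∀ x ∈ M, ‖f x‖ ≤ C * ‖x‖) ∧
    (∃ c > (0 : ℝ), ∀ x ∈ M, c * ‖x‖ ≤ ‖f x‖)

end Defs

/-- An ideal of finite type elements in the sense of Kečkić–Lazović: a self-adjoint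
two-sided ideal with an approximate unit consisting of projections, such that for any
two projections `p, q` in it there is `v` with `v v* = q` and `v* v ⊥ p`. -/
structure FiniteTypeIdeal (A : Type*) [CStarAlgebra A] where
  carrier : Set A
  zero_mem : (0 : A) ∈ carrier
  add_mem : ∀ {x y : A}, x ∈ carrier → y ∈ carrier → x + y ∈ carrier
  mul_left_mem : ∀ (a : A) {x : A}, x ∈ carrier → a * x ∈ carrier
  mul_right_mem : ∀ (a : A) {x : A}, x ∈ carrier → x * a ∈ carrier
  star_mem : ∀ {x : A}, x ∈ carrier → star x ∈ carrier
  approx_unit : ∀ x ∈ carrier, ∀ ε > (0 : ℝ), ∃ p ∈ carrier, IsProjn p ∧ ‖x - p * x‖ < ε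
  orth_exists : ∀ p q : A, p ∈ carrier → q ∈ carrier → IsProjn p → IsProjn q →
    ∃ v : A, v * star v = q ∧ star v * v * p = 0 ∧ IsProjn (star v * v + p)

section Defs2

variable {A : Type*} [CStarAlgebra A]

/-- `OrthSumList L s` : `s` is a sum of pairwise orthogonal projections equivalent
(one by one) to the members of the list `L`.  Used to express sums of classes in the
semigroup `S(F)` of Murray–von Neumann classes of projections. -/
inductive OrthSumList : List A → A → Prop
  | nil : OrthSumList [] 0
  | cons {p p' s : A} {L : List A} : MvN p p' → OrthSumList L s → p' * s = 0 →
      OrthSumList (p :: L) (p' + s)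

/-- Equality of the formal sums of the classes of the projections in `L1` and in `L2`
in the Grothendieck group `K(F)` of the semigroup of Murray–von Neumann classes of
projections in `Fc`:  `Σ [L1] = Σ [L2]` in `K(F)` iff `Σ [L1] + [r] = Σ [L2] + [r]`
holds in the semigroup for some projection `r ∈ Fc`. -/
def KEqList (Fc : Set A) (L1 L2 : List A) : Prop :=
  ∃ r s t : A, IsProjn r ∧ r ∈ Fc ∧ OrthSumList (L1 ++ [r]) s ∧
    OrthSumList (L2 ++ [r]) t ∧ MvN s t

/-- `F` admits a decomposition `A = M₁ ⊕̃ N₁ → M₂ ⊕̃ N₂ = A` with respect to which it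
is diagonal `diag(F₁, F₄)`, with `F₁ : M₁ → M₂` an isomorphism, and `pN1, pN2` are the
orthogonal projections onto `N₁, N₂`. -/
def HasDiagDecomp (F pN1 pN2 : A) : Prop :=
  ∃ M1 N1 M2 N2 : Set A,
    IsClosedSubmodule M1 ∧ IsClosedSubmodule N1 ∧ IsClosedSubmodule M2 ∧
    IsClosedSubmodule N2 ∧ IsComplPair M1 N1 ∧ IsComplPair M2 N2 ∧
    IsIsoOn F M1 M2 ∧ (∀ x ∈ N1, F * x ∈ N2) ∧
    IsOrthProjOnto pN1 N1 ∧ IsOrthProjOnto pN2 N2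

/-- The Mishchenko–Fomenko type Fredholm class `MKΦ(A)` relative to the ideal `Fc`:
`F` has a diagonalizing decomposition whose corner projections lie in `Fc`.
Its index is `[pN1] - [pN2] ∈ K(F)`. -/
def MKPhi (Fc : FiniteTypeIdeal A) (F n1 n2 : A) : Prop :=
  HasDiagDecomp F n1 n2 ∧ n1 ∈ Fc.carrier ∧ n2 ∈ Fc.carrier

end Defs2

section Helpers

open Matrix

/-- Algebraic equivalence of idempotent matrices. -/
def AlgEq {A : Type*} [Ring A] {m n : ℕ} (P : Matrix (Fin m) (Fin m) A)
    (Q : Matrix (Fin n) (Fin n) A) : Prop :=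
  P * P = P ∧ Q * Q = Q ∧
  ∃ (X : Matrix (Fin m) (Fin n) A) (Y : Matrix (Fin n) (Fin m) A), X * Y = P ∧ Y * X = Q

theorem AlgEq.symm {A : Type*} [Ring A] {m n : ℕ} {P : Matrix (Fin m) (Fin m) A}
    {Q : Matrix (Fin n) (Fin n) A} (h : AlgEq P Q) : AlgEq Q P := by
  obtain ⟨hP, hQ, X, Y, h1, h2⟩ := h
  exact ⟨hQ, hP, Y, X, h2, h1⟩

theorem AlgEq.trans {A : Type*} [Ring A] {m n k : ℕ} {P : Matrix (Fin m) (Fin m) A}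
    {Q : Matrix (Fin n) (Fin n) A} {R : Matrix (Fin k) (Fin k) A}
    (h : AlgEq P Q) (h' : AlgEq Q R) : AlgEq P R := by
  obtain ⟨hP, hQ, X, Y, h1, h2⟩ := h
  obtain ⟨_, hR, Z, W, h3, h4⟩ := h'
  refine ⟨hP, hR, X * Z, W * Y, ?_, ?_⟩
  · calc X * Z * (W * Y) = X * (Z * W) * Y := by simp only [Matrix.mul_assoc]
      _ = (X * Y) * (X * Y) := by rw [h3, ← h2]; simp only [Matrix.mul_assoc]
      _ = P := by rw [h1, hP]
  · calc W * Y * (X * Z) = W * (Y * X) * Z := by simp only [Matrix.mul_assoc]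
      _ = (W * Z) * (W * Z) := by rw [h2, ← h3]; simp only [Matrix.mul_assoc]
      _ = R := by rw [h4, hR]

/-- Diagonal 3x3. -/
def dg {A : Type*} [Ring A] (a b c : A) : Matrix (Fin 3) (Fin 3) A :=
  !![a, 0, 0; 0, b, 0; 0, 0, c]

theorem dg_mul {A : Type*} [Ring A] (a b c a' b' c' : A) :
    dg a b c * dg a' b' c' = dg (a * a') (b * b') (c * c') := by
  ext i j
  fin_cases i <;> fin_cases j <;> simp [dg, Matrix.mul_apply, Fin.sum_univ_three]

/-- Algebraic equivalence of idempotents -/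
def AE {A : Type*} [Ring A] (a b : A) : Prop :=
  a * a = a ∧ b * b = b ∧ ∃ x y, x * y = a ∧ y * x = b

theorem AE.refl {A : Type*} [Ring A] {a : A} (h : a * a = a) : AE a a :=
  ⟨h, h, a, a, h, h⟩

theorem dg_congr {A : Type*} [Ring A] {a b c a' b' c' : A} (h1 : AE a a') (h2 : AE b b')
    (h3 : AE c c') : AlgEq (dg a b c) (dg a' b' c') := by
  obtain ⟨p1, q1, x1, y1, r1, s1⟩ := h1
  obtain ⟨p2, q2, x2, y2, r2, s2⟩ := h2
  obtain ⟨p3, q3, x3, y3, r3, s3⟩ := h3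
  refine ⟨by rw [dg_mul, p1, p2, p3], by rw [dg_mul, q1, q2, q3], dg x1 x2 x3, dg y1 y2 y3, ?_, ?_⟩
  · rw [dg_mul, r1, r2, r3]
  · rw [dg_mul, s1, s2, s3]

theorem dg_swap {A : Type*} [Ring A] {a b c : A} (ha : a * a = a) (hb : b * b = b)
    (hc : c * c = c) : AlgEq (dg a b c) (dg b a c) := by
  refine ⟨by rw [dg_mul, ha, hb, hc], by rw [dg_mul, ha, hb, hc],
    !![0, a, 0; b, 0, 0; 0, 0, c], !![0, b, 0; a, 0, 0; 0, 0, c], ?_, ?_⟩ <;>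
  · ext i j
    fin_cases i <;> fin_cases j <;> simp [dg, Matrix.mul_apply, Fin.sum_univ_three, ha, hb, hc]

theorem dg_pair {A : Type*} [Ring A] {z a b c d : A} (hz : z * z = z)
    (ha : a * a = a) (hb : b * b = b) (hc : c * c = c) (hd : d * d = d)
    (x11 x12 x21 x22 y11 y12 y21 y22 : A)
    (h1 : x11 * y11 + x12 * y21 = a) (h2 : x11 * y12 + x12 * y22 = 0)
    (h3 : x21 * y11 + x22 * y21 = 0) (h4 : x21 * y12 + x22 * y22 = b)
    (k1 : y11 * x11 + y12 * x21 = c) (k2 : y11 * x12 + y12 * x22 = 0)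
    (k3 : y21 * x11 + y22 * x21 = 0) (k4 : y21 * x12 + y22 * x22 = d) :
    AlgEq (dg z a b) (dg z c d) := by
  refine ⟨by rw [dg_mul, hz, ha, hb], by rw [dg_mul, hz, hc, hd],
    !![z, 0, 0; 0, x11, x12; 0, x21, x22], !![z, 0, 0; 0, y11, y12; 0, y21, y22], ?_, ?_⟩ <;>
  · ext i j
    fin_cases i <;> fin_cases j <;> simp [dg, Matrix.mul_apply, Fin.sum_univ_three, *]

/-- Data extracted from a diagonal decomposition. -/
structure Dat {A : Type*} [Ring A] (F e f g : A) : Prop where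
  ee : e * e = e
  ff : f * f = f
  Fe : f * F = F * e
  gF : g * F = 1 - e
  Fg : F * g = 1 - f
  eg : e * g = 0
  gf : g * f = 0

theorem pair_equiv {A : Type*} [Ring A] {F e f g r k z : A} (hd : Dat F e f g)
    (hz : z * z = z) (hr : r * r = r) (hk : k * F * (1 - r) = 1 - r) (hrk : r * k = 0) :
    AlgEq (dg z f r) (dg z e (1 - F * k)) := by
  obtain ⟨ee, ff, Fe, gF, Fg, eg, gf⟩ := hd
  have kk : k * F * k = k := by
    have : k * F * (1 - r) * k = (1 - r) * k := by rw [hk]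
    simp only [sub_mul, mul_sub, one_mul, mul_one] at this
    rw [mul_assoc (k * F) r k, hrk] at this
    simpa using this
  have qF : F * k * F * (1 - r) = F * (1 - r) := by
    rw [mul_assoc F k F, mul_assoc, hk]
  have kFr : k * F * r = k * F - 1 + r := by
    rw [mul_sub, mul_one] at hk
    rw [← sub_eq_zero] at hk ⊢
    rw [← neg_eq_zero, ← hk]; abel
  have Fer : f * F * e = F * e := by rw [Fe, mul_assoc, ee]
  have e1 : ∀ x, e * (e * x) = e * x := fun x => by rw [← mul_assoc, ee]
  have e2 : ∀ x, f * (f * x) = f * x := fun x => by rw [← mul_assoc, ff]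
  have e3 : ∀ x, f * (F * x) = F * (e * x) := fun x => by rw [← mul_assoc, Fe, mul_assoc]
  have e4 : ∀ x, g * (F * x) = x - e * x := fun x => by rw [← mul_assoc, gF, sub_mul, one_mul]
  have e5 : ∀ x, F * (g * x) = x - f * x := fun x => by rw [← mul_assoc, Fg, sub_mul, one_mul]
  have e6 : ∀ x, e * (g * x) = 0 := fun x => by rw [← mul_assoc, eg, zero_mul]
  have e7 : ∀ x, g * (f * x) = 0 := fun x => by rw [← mul_assoc, gf, zero_mul]
  have e8 : ∀ x, r * (r * x) = r * x := fun x => by rw [← mul_assoc, hr]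
  have e9 : ∀ x, r * (k * x) = 0 := fun x => by rw [← mul_assoc, hrk, zero_mul]
  have e10 : k * (F * k) = k := by rw [← mul_assoc, kk]
  have e11 : ∀ x, k * (F * (k * x)) = k * x := fun x => by
    rw [← mul_assoc, ← mul_assoc, kk]
  have e12 : k * (F * r) = k * F - 1 + r := by rw [← mul_assoc, kFr]
  have e13 : ∀ x, k * (F * (r * x)) = k * (F * x) - x + r * x := fun x => by
    rw [← mul_assoc, ← mul_assoc, kFr]; noncomm_ring
  have qq : (1 - F * k) * (1 - F * k) = 1 - F * k := by
    simp only [sub_mul, mul_sub, one_mul, mul_one, mul_assoc, e10]; abel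
  refine dg_pair hz ff hr ee qq (-(F * e)) (f * (1 - F * k)) (r * e) (r * g * (1 - F * k))
    (-(e * k * f)) (e * (1 - k * F) * r) ((1 - F * k) * f) ((1 - F * k) * F * r)
    ?_ ?_ ?_ ?_ ?_ ?_ ?_ ?_
  all_goals
    simp only [sub_mul, mul_sub, mul_add, add_mul, one_mul, mul_one, mul_assoc, neg_mul, mul_neg,
      mul_zero, sub_zero, zero_sub, neg_neg,
      ee, ff, Fe, gF, Fg, eg, gf, hr, hrk, e1, e3, e4, e8, e9, e11, e12, e13]
    try abel

theorem q_equiv {A : Type*} [Ring A] {F r k k' : A}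
    (hk : k * F * (1 - r) = 1 - r) (hrk : r * k = 0)
    (hk' : k' * F * (1 - r) = 1 - r) (hrk' : r * k' = 0) :
    AE (1 - F * k) (1 - F * k') := by
  have key : ∀ a b : A, a * F * (1 - r) = 1 - r → r * b = 0 →
      (1 - F * a) * (1 - F * b) = 1 - F * a := by
    intro a b ha hb
    have h1 : F * a * (F * b) = F * b := by
      have : b = (1 - r) * b := by rw [sub_mul, hb]; simp
      calc F * a * (F * b) = F * (a * F * b) := by simp only [mul_assoc]
        _ = F * (a * F * ((1 - r) * b)) := by rw [← this]
        _ = F * (a * F * (1 - r) * b) := by simp only [mul_assoc]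
        _ = F * b := by rw [ha, ← this]
    simp only [sub_mul, mul_sub, one_mul, mul_one, h1]; abel
  exact ⟨key k k hk hrk, key k' k' hk' hrk', 1 - F * k, 1 - F * k', key k k' hk hrk',
    key k' k hk' hrk⟩

theorem k_exists {A : Type*} [CStarAlgebra A] {F e f g r : A} (hd : Dat F e f g)
    (hr : r * r = r) (hn : ‖e * (1 - r)‖ < 1) :
    ∃ k, k * F * (1 - r) = 1 - r ∧ r * k = 0 := by
  have hu : IsUnit (1 - e * (1 - r)) := isUnit_one_sub_of_norm_lt_one hn
  obtain ⟨u, hu⟩ := hu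
  refine ⟨(1 - r) * (↑u⁻¹ : A) * g, ?_, ?_⟩
  · have h1 : (1 - r) * (1 - r) = 1 - r := by
      simp only [sub_mul, mul_sub, one_mul, mul_one, hr]; abel
    have h2 : g * F * (1 - r) = u * (1 - r) := by
      rw [hd.gF, hu, sub_mul, sub_mul, mul_assoc e, h1]
    calc (1 - r) * (↑u⁻¹ : A) * g * F * (1 - r)
        = (1 - r) * (↑u⁻¹ : A) * (g * F * (1 - r)) := by simp only [mul_assoc]
      _ = (1 - r) * ((↑u⁻¹ : A) * u) * (1 - r) := by rw [h2]; simp only [mul_assoc]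
      _ = 1 - r := by rw [Units.inv_mul, mul_one, h1]
  · have : r * (1 - r) = 0 := by rw [mul_sub, hr, mul_one, sub_self]
    rw [← mul_assoc, ← mul_assoc, this]; simp

theorem compl_idem {A : Type*} [CStarAlgebra A] {M N : Set A} (hM : IsClosedSubmodule M)
    (hN : IsClosedSubmodule N) (hc : IsComplPair M N) :
    ∃ e ∈ N, 1 - e ∈ M ∧ (∀ x ∈ N, e * x = x) ∧ (∀ x ∈ M, e * x = 0) := by
  obtain ⟨-, -, aM, mM, nM, -⟩ := hM
  obtain ⟨-, -, aN, mN, nN, -⟩ := hN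
  obtain ⟨hi, hs⟩ := hc
  obtain ⟨m, hm, e, he, h1⟩ := hs 1
  have hme : 1 - e = m := by rw [h1]; simp
  refine ⟨e, he, hme ▸ hm, ?_, ?_⟩
  · intro x hx
    have h2 : (1 - e) * x ∈ M := hme ▸ mM m hm x
    have h3 : (1 - e) * x ∈ N := by
      have := aN x hx _ (nN _ (mN e he x))
      rwa [show (1 - e) * x = x + -(e * x) by noncomm_ring]
    have h4 : (1 - e) * x = 0 := hi ⟨h2, h3⟩
    rw [sub_mul, one_mul, sub_eq_zero] at h4
    exact h4.symm
  · intro x hx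
    have h2 : e * x ∈ N := mN e he x
    have h3 : e * x ∈ M := by
      have := aM x hx _ (nM _ (mM _ hm x))
      rw [← hme] at this
      rwa [show e * x = x + -((1 - e) * x) by noncomm_ring]
    exact hi ⟨h3, h2⟩

theorem dat_exists {A : Type*} [CStarAlgebra A] {F n1 n2 : A} (h : HasDiagDecomp F n1 n2) :
    ∃ e f g, Dat F e f g ∧ n1 * e = e ∧ e * n1 = n1 ∧ n2 * f = f ∧ f * n2 = n2 ∧
      IsProjn n1 ∧ IsProjn n2 := by
  obtain ⟨M1, N1, M2, N2, hM1, hN1, hM2, hN2, hc1, hc2, ⟨i1, i2, c, hc, i3⟩, hF, hp1, hp2⟩ := h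
  obtain ⟨e, he, he', heN, heM⟩ := compl_idem hM1 hN1 hc1
  obtain ⟨f, hf, hf', hfN, hfM⟩ := compl_idem hM2 hN2 hc2
  obtain ⟨g, hg, hFg⟩ := i2 _ hf'
  have inj : ∀ x ∈ M1, F * x = 0 → x = 0 := by
    intro x hx h0
    have := i3 x hx
    rw [h0, norm_zero] at this
    have h2 : ‖x‖ ≤ 0 := by
      by_contra hh
      push Not at hh
      have := mul_pos hc hh
      linarith
    exact norm_le_zero_iff.mp h2
  have hfF : f * F = F * e := by
    have a1 := hfN _ (hF e he)
    have a2 := hfM _ (i1 _ he')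
    rw [mul_sub, mul_sub, mul_one, a1, sub_eq_zero] at a2
    exact a2
  have hff := hfN f hf
  obtain ⟨-, -, aM, mM, nM, -⟩ := hM1
  obtain ⟨s1, p1, hN1'⟩ := hp1
  obtain ⟨s2, p2, hN2'⟩ := hp2
  refine ⟨e, f, g, ⟨heN e he, hff, hfF, ?_, hFg, heM g hg, ?_⟩, ?_, ?_, ?_, ?_, ⟨s1, p1⟩, ⟨s2, p2⟩⟩
  · have hm : g * F + -(1 - e) ∈ M1 := aM _ (mM g hg F) _ (nM _ he')
    have := inj _ hm (by
      rw [mul_add, ← mul_assoc, hFg, sub_mul, hfF]; noncomm_ring)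
    rw [← sub_eq_add_neg, sub_eq_zero] at this
    exact this
  · exact inj _ (mM g hg f) (by rw [← mul_assoc, hFg, sub_mul, hff, one_mul, sub_self])
  · rw [hN1'] at he; exact he
  · exact heN _ (by rw [hN1']; exact p1)
  · rw [hN2'] at hf; exact hf
  · exact hfN _ (by rw [hN2']; exact p2)

theorem mvn_of_AE {A : Type*} [CStarAlgebra A] {p q : A} (hp : IsProjn p) (hq : IsProjn q)
    (h : AE p q) : MvN q p := by
  letI : PartialOrder A := CStarAlgebra.spectralOrder A
  haveI : StarOrderedRing A := CStarAlgebra.spectralOrderedRing A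
  obtain ⟨sp, pp⟩ := hp
  obtain ⟨sq, qq⟩ := hq
  obtain ⟨x, y, hxq, hpx, hyp, hqy, hxy, hyx⟩ : ∃ x y : A, x * q = x ∧ p * x = x ∧ y * p = y ∧
      q * y = y ∧ x * y = p ∧ y * x = q := by
    obtain ⟨-, -, x, y, hxy, hyx⟩ := h
    refine ⟨p * x * q, q * y * p, ?_, ?_, ?_, ?_, ?_, ?_⟩
    · rw [mul_assoc, qq]
    · rw [← mul_assoc, ← mul_assoc, pp]
    · rw [mul_assoc, pp]
    · rw [← mul_assoc, ← mul_assoc, qq]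
    · calc p * x * q * (q * y * p) = p * x * (q * q) * y * p := by simp only [mul_assoc]
        _ = p * (x * y) * (x * y) * p := by rw [qq, ← hyx]; simp only [mul_assoc]
        _ = p := by rw [hxy, pp, pp, pp]
    · calc q * y * p * (p * x * q) = q * y * (p * p) * x * q := by simp only [mul_assoc]
        _ = q * (y * x) * (y * x) * q := by rw [pp, ← hxy]; simp only [mul_assoc]
        _ = q := by rw [hyx, qq, qq, qq]
  have hxs : q * star x = star x := by
    rw [← sq.star_eq, ← star_mul, hxq]
  have hxs' : star x * p = star x := by
    rw [← sp.star_eq, ← star_mul, hpx]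
  have hys : star y * q = star y := by
    rw [← sq.star_eq, ← star_mul, hqy]
  have hys' : p * star y = star y := by
    rw [← sp.star_eq, ← star_mul, hyp]
  have hsxy : star y * star x = p := by rw [← star_mul, hxy, sp.star_eq]
  have hsyx : star x * star y = q := by rw [← star_mul, hyx, sq.star_eq]
  have q1 : (1 - q) * (1 - q) = 1 - q := by
    simp only [sub_mul, mul_sub, one_mul, mul_one, qq]; abel
  set E := y * star y + (1 - q) with hE
  set D := star x * x + (1 - q) with hD
  have E0 : 0 ≤ E := by
    refine add_nonneg (mul_star_self_nonneg y) ?_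
    have : star (1 - q) * (1 - q) = 1 - q := by rw [star_sub, star_one, sq.star_eq, q1]
    rw [← this]; exact star_mul_self_nonneg _
  have qE : q * E = y * star y := by
    rw [hE, mul_add, mul_sub, qq, mul_one, sub_self, add_zero, ← mul_assoc, hqy]
  have Eq : E * q = y * star y := by
    rw [hE, add_mul, sub_mul, qq, one_mul, sub_self, add_zero, mul_assoc, hys]
  have xx : star x * x * (y * star y) = q := by
    calc star x * x * (y * star y) = star x * (x * y) * star y := by simp only [mul_assoc]
      _ = q := by rw [hxy, hxs', hsyx]
  have yy : (y * star y) * (star x * x) = q := by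
    calc (y * star y) * (star x * x) = y * (star y * star x) * x := by simp only [mul_assoc]
      _ = q := by rw [hsxy, hyp, hyx]
  have xE : star x * x * E = q := by
    rw [hE, mul_add, xx, mul_sub, mul_one, mul_assoc, hxq, sub_self, add_zero]
  have Ex : E * (star x * x) = q := by
    rw [hE, add_mul, yy, sub_mul, one_mul, ← mul_assoc, hxs, sub_self, add_zero]
  have cxE : Commute E (star x * x) := by rw [Commute, SemiconjBy, xE, Ex]
  have hh : CFC.sqrt E * CFC.sqrt E = E := CFC.sqrt_mul_sqrt_self E E0
  have hs : star (CFC.sqrt E) = CFC.sqrt E := (CFC.sqrt_nonneg E).isSelfAdjoint.star_eq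
  have hc : Commute (CFC.sqrt E) (star x * x) := by
    exact Commute.cfcₙ_nnreal cxE _
  refine ⟨x * CFC.sqrt E, ?_, ?_⟩
  · rw [star_mul, hs]
    calc x * CFC.sqrt E * (CFC.sqrt E * star x)
        = x * (CFC.sqrt E * CFC.sqrt E) * star x := by simp only [mul_assoc]
      _ = x * (E * q) * star x := by rw [hh, mul_assoc x (E * q), mul_assoc E, hxs, mul_assoc]
      _ = (x * y) * (star y * star x) := by rw [Eq]; simp only [mul_assoc]
      _ = p := by rw [hxy, hsxy, pp]
  · rw [star_mul, hs]
    calc CFC.sqrt E * star x * (x * CFC.sqrt E)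
        = (CFC.sqrt E * (star x * x)) * CFC.sqrt E := by simp only [mul_assoc]
      _ = star x * x * E := by rw [hc.eq, mul_assoc, hh]
      _ = q := xE

theorem r_exists {A : Type*} [CStarAlgebra A] (Fc : FiniteTypeIdeal A) {e e' : A}
    (he : e ∈ Fc.carrier) (he' : e' ∈ Fc.carrier) :
    ∃ r ∈ Fc.carrier, IsProjn r ∧ ‖e * (1 - r)‖ < 1 ∧ ‖e' * (1 - r)‖ < 1 := by
  letI : PartialOrder A := CStarAlgebra.spectralOrder A
  haveI : StarOrderedRing A := CStarAlgebra.spectralOrderedRing A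
  obtain ⟨r, hr, pr, hn⟩ := Fc.approx_unit (star e * e + star e' * e')
    (Fc.add_mem (Fc.mul_left_mem _ he) (Fc.mul_left_mem _ he')) 1 one_pos
  set X := star e * e + star e' * e' with hX
  have sr : star (1 - r) = 1 - r := by rw [star_sub, star_one, pr.1.star_eq]
  have rr : (1 - r) * (1 - r) = 1 - r := by
    simp only [sub_mul, mul_sub, one_mul, mul_one, pr.2]; abel
  have n1 : ‖1 - r‖ ≤ 1 := by
    have h := CStarRing.norm_star_mul_self (x := 1 - r)
    rw [sr, rr] at h
    nlinarith [norm_nonneg (1 - r)]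
  have hb : ‖star (1 - r) * X * (1 - r)‖ < 1 := by
    have h2 : star (1 - r) * X = X - r * X := by rw [sr, sub_mul, one_mul]
    rw [h2]
    calc ‖(X - r * X) * (1 - r)‖ ≤ ‖X - r * X‖ * ‖1 - r‖ := norm_mul_le _ _
      _ ≤ ‖X - r * X‖ * 1 := by gcongr
      _ < 1 := by rwa [mul_one]
  have key : ∀ a : A, star a * a ≤ X → ‖a * (1 - r)‖ < 1 := by
    intro a ha
    have h1 : star (1 - r) * (star a * a) * (1 - r) ≤ star (1 - r) * X * (1 - r) :=
      star_left_conjugate_le_conjugate ha _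
    have h3 : star (a * (1 - r)) * (a * (1 - r)) = star (1 - r) * (star a * a) * (1 - r) := by
      rw [star_mul]; simp only [mul_assoc]
    have h2 := CStarAlgebra.norm_le_norm_of_nonneg_of_le
      (h3 ▸ star_mul_self_nonneg (a * (1 - r))) h1
    rw [← h3, CStarRing.norm_star_mul_self] at h2
    nlinarith [norm_nonneg (a * (1 - r))]
  refine ⟨r, hr, pr, key e ?_, key e' ?_⟩
  · exact le_add_of_nonneg_right (star_mul_self_nonneg _)
  · exact le_add_of_nonneg_left (star_mul_self_nonneg _)

theorem orth_proj {A : Type*} [CStarAlgebra A] (Fc : FiniteTypeIdeal A) {p q : A}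
    (hp : p ∈ Fc.carrier) (hq : q ∈ Fc.carrier) (ip : IsProjn p) (iq : IsProjn q) :
    ∃ q' ∈ Fc.carrier, IsProjn q' ∧ MvN q q' ∧ q' * p = 0 ∧ p * q' = 0 ∧ IsProjn (q' + p) := by
  obtain ⟨v, h1, h2, h3⟩ := Fc.orth_exists p q hp hq ip iq
  have hs : IsSelfAdjoint (star v * v) := IsSelfAdjoint.star_mul_self v
  have h2' : p * (star v * v) = 0 := by
    have := congrArg star h2
    rwa [star_mul, hs.star_eq, ip.1.star_eq, star_zero] at this
  have hi : star v * v * (star v * v) = star v * v := by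
    have := h3.2
    rw [mul_add, add_mul, add_mul, h2, h2', ip.2, add_zero, zero_add] at this
    exact add_right_cancel this
  refine ⟨star v * v, ?_, ⟨hs, hi⟩, ⟨star v, by rw [star_star], by rw [star_star, h1]⟩, h2, h2', h3⟩
  have : star v * v = star v * (q * v) := by
    rw [← h1]; nth_rewrite 1 [← hi]; simp only [mul_assoc]
  rw [this]
  exact Fc.mul_left_mem _ (Fc.mul_right_mem _ hq)

theorem emb_exists {A : Type*} [CStarAlgebra A] {p p' : A} (ip : IsProjn p) (ip' : IsProjn p')
    (h : MvN p p') : ∃ a b : A, a * b = p' ∧ b * a = p ∧ p' * a = a ∧ b * p' = b := by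
  obtain ⟨w, h1, h2⟩ := h
  refine ⟨p' * w, star w * p', ?_, ?_, ?_, ?_⟩
  · calc p' * w * (star w * p') = p' * (w * star w) * p' := by simp only [mul_assoc]
      _ = p' := by rw [h1, ip'.2, ip'.2]
  · calc star w * p' * (p' * w) = star w * (p' * p') * w := by simp only [mul_assoc]
      _ = (star w * w) * (star w * w) := by rw [ip'.2, ← h1]; simp only [mul_assoc]
      _ = p := by rw [h2, ip.2]
  · rw [← mul_assoc, ip'.2]
  · rw [mul_assoc, ip'.2]

theorem rep_exists {A : Type*} [CStarAlgebra A] (Fc : FiniteTypeIdeal A) {p1 p2 p3 : A}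
    (h1 : p1 ∈ Fc.carrier) (h2 : p2 ∈ Fc.carrier) (h3 : p3 ∈ Fc.carrier)
    (i1 : IsProjn p1) (i2 : IsProjn p2) (i3 : IsProjn p3) :
    ∃ s, IsProjn s ∧ OrthSumList [p1, p2, p3] s ∧ AlgEq (dg p1 p2 p3) !![s] := by
  obtain ⟨q2, c2, j2, m2, o23, o32, is⟩ := orth_proj Fc h3 h2 i3 i2
  obtain ⟨q1, c1, j1, m1, o1, o1', it⟩ := orth_proj Fc (Fc.add_mem c2 h3) h1 is i1
  have m3 : MvN p3 p3 := ⟨p3, by rw [i3.1.star_eq, i3.2], by rw [i3.1.star_eq, i3.2]⟩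
  have o12 : q1 * q2 = 0 := by
    have := congrArg (· * q2) o1
    simpa [mul_add, add_mul, mul_assoc, j2.2, o32] using this
  have o13 : q1 * p3 = 0 := by
    have := congrArg (· * p3) o1
    simpa [mul_add, add_mul, mul_assoc, i3.2, o23] using this
  have o21 : q2 * q1 = 0 := by
    have := congrArg (q2 * ·) o1'
    simpa [mul_add, add_mul, ← mul_assoc, j2.2, o23] using this
  have o31 : p3 * q1 = 0 := by
    have := congrArg (p3 * ·) o1'
    simpa [mul_add, add_mul, ← mul_assoc, i3.2, o32] using this
  refine ⟨q1 + (q2 + p3), it, ?_, ?_⟩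
  · have t3 : OrthSumList [p3] (p3 + 0) := OrthSumList.cons m3 OrthSumList.nil (mul_zero _)
    rw [add_zero] at t3
    exact OrthSumList.cons m1 (OrthSumList.cons m2 t3 o23) o1
  · obtain ⟨a1, b1, r1, s1, t1, u1⟩ := emb_exists i1 j1 m1
    obtain ⟨a2, b2, r2, s2, t2, u2⟩ := emb_exists i2 j2 m2
    obtain ⟨a3, b3, r3, s3, t3, u3⟩ := emb_exists i3 i3 m3
    have key : ∀ {b q q' a : A}, b * q = b → q' * a = a → q * q' = 0 → b * a = 0 := by
      intro b q q' a hb ha hq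
      rw [← hb, ← ha, mul_assoc, ← mul_assoc q, hq]; simp
    have e12 := key u1 t2 o12
    have e13 := key u1 t3 o13
    have e21 := key u2 t1 o21
    have e23 := key u2 t3 o23
    have e31 := key u3 t1 o31
    have e32 := key u3 t2 o32
    refine ⟨by rw [dg_mul, i1.2, i2.2, i3.2], ?_, !![b1; b2; b3], !![a1, a2, a3], ?_, ?_⟩
    · ext i j
      fin_cases i; fin_cases j
      simpa [Matrix.mul_apply] using it.2
    · ext i j
      fin_cases i <;> fin_cases j <;>
        simp [dg, Matrix.mul_apply, s1, s2, s3, e12, e13, e21, e23, e31, e32]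
    · ext i j
      fin_cases i; fin_cases j
      simp [Matrix.mul_apply, Fin.sum_univ_three, r1, r2, r3, add_assoc]

end Helpers

/-- the index is well defined: any two `MKΦ`-decompositions of `F`
give the same element `[P_{N₁}] - [P_{N₂}] = [P_{N₁'}] - [P_{N₂'}]` of `K(F)`. -/
theorem stmt_11 {A : Type*} [CStarAlgebra A] (Fc : FiniteTypeIdeal A) (F n1 n2 m1 m2 : A)
    (h1 : MKPhi Fc F n1 n2) (h2 : MKPhi Fc F m1 m2) :
    KEqList Fc.carrier [n1, m2] [m1, n2] := by
  
  obtain ⟨d1, hn1, hn2⟩ := h1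
  obtain ⟨d2, hm1, hm2⟩ := h2
  obtain ⟨e, f, g, hd, a1, a2, a3, a4, pn1, pn2⟩ := dat_exists d1
  obtain ⟨e', f', g', hd', b1, b2, b3, b4, pm1, pm2⟩ := dat_exists d2
  have heF : e ∈ Fc.carrier := a1 ▸ Fc.mul_right_mem e hn1
  have heF' : e' ∈ Fc.carrier := b1 ▸ Fc.mul_right_mem e' hm1
  obtain ⟨r, hr, pr, hre, hre'⟩ := r_exists Fc heF heF'
  obtain ⟨k, hk, hrk⟩ := k_exists hd pr.2 hre
  obtain ⟨k', hk', hrk'⟩ := k_exists hd' pr.2 hre'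
  have aen1 : AE n1 e := ⟨pn1.2, hd.ee, e, n1, a2, a1⟩
  have aen2 : AE f n2 := ⟨hd.ff, pn2.2, n2, f, a3, a4⟩
  have aem1 : AE e' m1 := ⟨hd'.ee, pm1.2, m1, e', b1, b2⟩
  have aem2 : AE m2 f' := ⟨pm2.2, hd'.ff, f', m2, b4, b3⟩
  have hq := q_equiv hk' hrk' hk hrk
  have main : AlgEq (dg n1 m2 r) (dg m1 n2 r) :=
    (dg_congr aen1 aem2 (AE.refl pr.2)).trans <|
    (pair_equiv hd' hd.ee pr.2 hk' hrk').trans <|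
    (dg_congr (AE.refl hd.ee) (AE.refl hd'.ee) hq).trans <|
    (dg_swap hd.ee hd'.ee hq.2.1).trans <|
    (pair_equiv hd hd'.ee pr.2 hk hrk).symm.trans <|
    dg_congr aem1 aen2 (AE.refl pr.2)
  obtain ⟨s, ps, os, qs⟩ := rep_exists Fc hn1 hm2 hr pn1 pm2 pr
  obtain ⟨t, pt, ot, qt⟩ := rep_exists Fc hm1 hn2 hr pm1 pn2 pr
  obtain ⟨-, -, X, Y, hX, hY⟩ := qt.symm.trans (main.symm.trans qs)
  refine ⟨r, s, t, pr, hr, os, ot, mvn_of_AE pt ps ⟨pt.2, ps.2, X 0 0, Y 0 0, ?_, ?_⟩⟩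
  · simpa [Matrix.mul_apply] using congrFun (congrFun hX 0) 0
  · simpa [Matrix.mul_apply] using congrFun (congrFun hY 0) 0
end

section
/- If F, D ∈ MKΦ(A) are Fredholm in the sense of admitting MKΦ-decompositions relative to an ideal F of finite type elements, then the composition DF ∈ MKΦ(A) and index(DF) = index(D) + index(F) in K(F). -/
section Alg
variable {A : Type*} [Ring A]

/-- The right submodule `{x | e x = x}` of `A`. -/
def Rg (e : A) : Submodule Aᵐᵒᵖ A where
  carrier := {x | e * x = x}
  add_mem' := by
    intro x y hx hy
    simp only [Set.mem_ofPred_eq] at *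
    rw [mul_add, hx, hy]
  zero_mem' := by simp
  smul_mem' := by
    intro c x hx
    simp only [Set.mem_ofPred_eq] at *
    rw [MulOpposite.smul_eq_mul_unop, ← mul_assoc, hx]

theorem Rg_mem {e x : A} : x ∈ Rg e ↔ e * x = x := Iff.rfl

/-- Algebraically equivalent elements have isomorphic ranges. -/
def RgEquiv {e e' : A} (a b : A) (h1 : b * a = e) (h2 : a * b = e') : Rg e ≃ₗ[Aᵐᵒᵖ] Rg e' where
  toFun x := ⟨a * x.1, by
    have hx : e * x.1 = x.1 := x.2
    rw [Rg_mem, ← h2, ← mul_assoc, mul_assoc a b a, h1, mul_assoc a, hx]⟩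
  invFun x := ⟨b * x.1, by
    have hx : e' * x.1 = x.1 := x.2
    rw [Rg_mem, ← h1, ← mul_assoc, mul_assoc b a b, h2, mul_assoc b, hx]⟩
  map_add' x y := by ext; simp [mul_add]
  map_smul' c x := by ext; simp [MulOpposite.smul_eq_mul_unop, mul_assoc]
  left_inv x := by
    ext
    have hx : e * x.1 = x.1 := x.2
    simp only [← mul_assoc, h1, hx]
  right_inv x := by
    ext
    have hx : e' * x.1 = x.1 := x.2
    simp only [← mul_assoc, h2, hx]

/-- Range of an orthogonal sum of idempotents. -/
def RgSum {p s : A} (hp : p * p = p) (hs : s * s = s) (h1 : p * s = 0) (h2 : s * p = 0) :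
    Rg (p + s) ≃ₗ[Aᵐᵒᵖ] (Rg p × Rg s) where
  toFun x := (⟨p * x.1, by rw [Rg_mem, ← mul_assoc, hp]⟩, ⟨s * x.1, by rw [Rg_mem, ← mul_assoc, hs]⟩)
  invFun x := ⟨x.1.1 + x.2.1, by
    have hx : p * x.1.1 = x.1.1 := x.1.2
    have hy : s * x.2.1 = x.2.1 := x.2.2
    have h3 : p * x.2.1 = 0 := by rw [← hy, ← mul_assoc, h1, zero_mul]
    have h4 : s * x.1.1 = 0 := by rw [← hx, ← mul_assoc, h2, zero_mul]
    rw [Rg_mem, add_mul, mul_add, mul_add, hx, hy, h3, h4, add_zero, zero_add]⟩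
  map_add' x y := by ext <;> simp [mul_add]
  map_smul' c x := by ext <;> simp [MulOpposite.smul_eq_mul_unop, mul_assoc]
  left_inv x := by
    ext
    have hx : (p + s) * x.1 = x.1 := x.2
    simpa [add_mul] using hx
  right_inv x := by
    have hx : p * x.1.1 = x.1.1 := x.1.2
    have hy : s * x.2.1 = x.2.1 := x.2.2
    have h3 : p * x.2.1 = 0 := by rw [← hy, ← mul_assoc, h1, zero_mul]
    have h4 : s * x.1.1 = 0 := by rw [← hx, ← mul_assoc, h2, zero_mul]
    ext
    · simp [mul_add, hx, h3]
    · simp [mul_add, hy, h4]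

/-- An isomorphism of ranges comes from an algebraic equivalence. -/
theorem alg_of_equiv {s t : A} (hs : s * s = s) (ht : t * t = t) (φ : Rg s ≃ₗ[Aᵐᵒᵖ] Rg t) :
    ∃ a b : A, b * a = s ∧ a * b = t ∧ t * a = a ∧ s * b = b := by
  let a := φ ⟨s, hs⟩
  let b := φ.symm ⟨t, ht⟩
  refine ⟨a.1, b.1, ?_, ?_, a.2, b.2⟩
  · have h : MulOpposite.op a.1 • b = ⟨s, hs⟩ := by
      rw [← map_smul]
      rw [LinearEquiv.symm_apply_eq]
      ext
      exact a.2
    exact congrArg Subtype.val h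
  · have h : MulOpposite.op b.1 • a = ⟨t, ht⟩ := by
      rw [← map_smul]
      rw [← LinearEquiv.eq_symm_apply]
      ext
      exact b.2
    exact congrArg Subtype.val h

/-- Core index computation: `[y] + [n] = [q] + [n']`, together with the data on `y`. -/
theorem core_lemma {F G n n' q v : A} (hn : n * n = n) (hn' : n' * n' = n')
    (hGF : G * F = 1 - n) (hFG : F * G = 1 - n') (hnG : n * G = 0) (hGn : G * n' = 0)
    (hq : q * q = q) (huv : (1 - n * (1 - q)) * v = 1) (hvu : v * (1 - n * (1 - q)) = 1) :
    ∃ y : A, F * (1 - q) * v * G = 1 - y ∧ y * y = y ∧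
      (1 - q) * v * G * (F * (1 - q)) = 1 - q ∧
      Nonempty ((Rg y × Rg n) ≃ₗ[Aᵐᵒᵖ] (Rg q × Rg n')) := by
  obtain ⟨q', hq'⟩ : ∃ q', q' = 1 - q := ⟨_, rfl⟩
  obtain ⟨m, hm⟩ : ∃ m, m = 1 - n := ⟨_, rfl⟩
  obtain ⟨m', hm'⟩ : ∃ m, m = 1 - n' := ⟨_, rfl⟩
  obtain ⟨u, hu⟩ : ∃ u, u = 1 - n * q' := ⟨_, rfl⟩
  rw [← hq', ← hu] at huv hvu
  rw [← hm] at hGF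
  rw [← hm'] at hFG
  rw [← hq']
  have hqq : q' * q' = q' := by simp [hq', mul_sub, sub_mul, hq]
  have hmm : m * m = m := by simp [hm, mul_sub, sub_mul, hn]
  have hmn : m * n = 0 := by simp [hm, mul_sub, sub_mul, hn]
  have hnm : n * m = 0 := by simp [hm, mul_sub, sub_mul, hn]
  have hmG : m * G = G := by rw [hm, sub_mul, hnG]; simp
  have hGm : G * m' = G := by rw [hm', mul_sub, hGn]; simp
  have huq : u * q' = m * q' := by rw [hu, hm, sub_mul, sub_mul, mul_assoc n, hqq]
  have hmF : m' * F = F * m := by rw [← hFG, mul_assoc, hGF]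
  have hnF : n' * F = F * n := by
    have : n' = 1 - m' := by rw [hm']; abel
    rw [this, sub_mul, hmF, hm]; noncomm_ring
  -- the left inverse property
  have hL : q' * v * G * (F * q') = q' := by
    calc q' * v * G * (F * q') = q' * v * ((G * F) * q') := by noncomm_ring
      _ = q' * (v * u) * q' := by rw [hGF, ← huq]; noncomm_ring
      _ = q' := by rw [hvu, mul_one, hqq]
  obtain ⟨P, hP⟩ : ∃ P, P = F * q' * v * G := ⟨_, rfl⟩
  have hPP : P * P = P := by
    calc P * P = F * (q' * v * G * (F * q')) * v * G := by rw [hP]; noncomm_ring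
      _ = P := by rw [hL, hP]
  obtain ⟨E, hE⟩ : ∃ E, E = u * q' * v := ⟨_, rfl⟩
  have hEE : E * E = E := by
    calc E * E = u * q' * (v * u) * q' * v := by rw [hE]; noncomm_ring
      _ = u * (q' * q') * v := by rw [hvu]; noncomm_ring
      _ = E := by rw [hqq, hE]
  have hmE : m * E = E := by
    rw [hE, huq, ← mul_assoc, ← mul_assoc, hmm]
  have hnE : n * E = 0 := by rw [← hmE, ← mul_assoc, hnm, zero_mul]
  obtain ⟨χ, hχ⟩ : ∃ χ, χ = m - E * m := ⟨_, rfl⟩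
  have hmχ : m * χ = χ := by rw [hχ, mul_sub, hmm, ← mul_assoc, hmE]
  have hχm : χ * m = χ := by rw [hχ, sub_mul, hmm, mul_assoc, hmm]
  have hEχ : E * χ = 0 := by rw [hχ, mul_sub, ← mul_assoc, hEE, sub_self]
  have hχχ : χ * χ = χ := by
    nth_rewrite 1 [hχ]
    rw [sub_mul, mul_assoc, hmχ, hEχ, sub_zero]
  have hnχ : n * χ = 0 := by rw [← hmχ, ← mul_assoc, hnm, zero_mul]
  have hχn : χ * n = 0 := by rw [← hχm, mul_assoc, hmn, mul_zero]
  have hsum : n + χ = 1 - E * m := by rw [hχ, hm]; noncomm_ring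
  have hEmE : E * m * E = E := by rw [mul_assoc, hmE, hEE]
  have hEEm : E * (E * m) = E * m := by rw [← mul_assoc, hEE]
  -- `q ~ 1 - E ~ 1 - E m = n + χ`
  have hqE : q = 1 - q' := by rw [hq']; abel
  have e1 : Rg q ≃ₗ[Aᵐᵒᵖ] Rg (1 - E) := RgEquiv (u * q) (q * v)
    (by
      calc q * v * (u * q) = q * (v * u) * q := by noncomm_ring
        _ = q := by rw [hvu, mul_one, hq])
    (by
      calc u * q * (q * v) = u * (q * q) * v := by noncomm_ring
        _ = u * v - u * q' * v := by rw [hq, hqE]; noncomm_ring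
        _ = 1 - E := by rw [huv, hE])
  have e2 : Rg (1 - E) ≃ₗ[Aᵐᵒᵖ] Rg (n + χ) := RgEquiv (1 - E * m) (1 - E)
    (by
      calc (1 - E) * (1 - E * m) = 1 - E - E * m + E * (E * m) := by noncomm_ring
        _ = 1 - E := by rw [hEEm]; abel)
    (by
      calc (1 - E * m) * (1 - E) = 1 - E - E * m + E * m * E := by noncomm_ring
        _ = n + χ := by rw [hEmE, hsum]; abel)
  have e3 : Rg q ≃ₗ[Aᵐᵒᵖ] (Rg n × Rg χ) := e1.trans (e2.trans (RgSum hn hχχ hnχ hχn))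
  -- the other side
  obtain ⟨χ', hχ'⟩ : ∃ χ', χ' = F * χ * G := ⟨_, rfl⟩
  have hχ'χ' : χ' * χ' = χ' := by
    calc χ' * χ' = F * χ * (G * F) * χ * G := by rw [hχ']; noncomm_ring
      _ = F * (χ * m * χ) * G := by rw [hGF]; noncomm_ring
      _ = χ' := by rw [hχm, hχχ, hχ']
  have hn'χ' : n' * χ' = 0 := by
    calc n' * χ' = (n' * F) * χ * G := by rw [hχ']; noncomm_ring
      _ = F * (n * χ) * G := by rw [hnF]; noncomm_ring
      _ = 0 := by rw [hnχ]; simp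
  have hχ'n' : χ' * n' = 0 := by rw [hχ', mul_assoc, hGn, mul_zero]
  have e4 : Rg χ ≃ₗ[Aᵐᵒᵖ] Rg χ' := RgEquiv (F * χ) (χ * G)
    (by
      calc χ * G * (F * χ) = χ * (G * F) * χ := by noncomm_ring
        _ = χ := by rw [hGF, hχm, hχχ])
    (by
      calc F * χ * (χ * G) = F * (χ * χ) * G := by noncomm_ring
        _ = χ' := by rw [hχχ, hχ'])
  have hPE : F * E * G = m' * P := by
    calc F * E * G = F * (u * q') * v * G := by rw [hE]; noncomm_ring
      _ = (F * m) * q' * v * G := by rw [huq]; noncomm_ring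
      _ = m' * P := by rw [← hmF, hP]; noncomm_ring
  have hsum' : n' + χ' = 1 - m' * P := by
    calc n' + χ' = n' + (F * (m * G)) - F * E * (m * G) := by rw [hχ', hχ]; noncomm_ring
      _ = 1 - m' * P := by rw [hmG, hFG, hPE, hm']; abel
  have hPm : P * m' = P := by rw [hP, mul_assoc, hGm]
  have e5 : Rg (1 - P) ≃ₗ[Aᵐᵒᵖ] Rg (n' + χ') := RgEquiv (1 - P) (1 - m' * P)
    (by
      calc (1 - m' * P) * (1 - P) = 1 - P - m' * P + m' * (P * P) := by noncomm_ring
        _ = 1 - P := by rw [hPP]; abel)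
    (by
      calc (1 - P) * (1 - m' * P) = 1 - P - m' * P + (P * m') * P := by noncomm_ring
        _ = n' + χ' := by rw [hPm, hPP, hsum']; abel)
  have e6 : Rg (1 - P) ≃ₗ[Aᵐᵒᵖ] (Rg n' × Rg χ) :=
    e5.trans ((RgSum hn' hχ'χ' hn'χ' hχ'n').trans
      (LinearEquiv.prodCongr (LinearEquiv.refl _ _) e4.symm))
  refine ⟨1 - P, by rw [hP]; abel, ?_, hL, ⟨?_⟩⟩
  · calc (1 - P) * (1 - P) = 1 - P - P + P * P := by noncomm_ring
      _ = 1 - P := by rw [hPP]; abel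
  · have e7 : ((Rg n' × Rg χ) × Rg n) ≃ₗ[Aᵐᵒᵖ] ((Rg n × Rg χ) × Rg n') :=
      { toFun := fun x => ((x.2, x.1.2), x.1.1)
        invFun := fun x => ((x.2, x.1.2), x.1.1)
        map_add' := fun _ _ => rfl
        map_smul' := fun _ _ => rfl
        left_inv := fun _ => rfl
        right_inv := fun _ => rfl }
    exact ((LinearEquiv.prodCongr e6 (LinearEquiv.refl _ (Rg n))).trans e7).trans
      (LinearEquiv.prodCongr e3.symm (LinearEquiv.refl _ (Rg n')))

end Alg

section CStar
variable {A : Type*} [CStarAlgebra A]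

theorem projn_one_sub_norm {q : A} (hq : IsProjn q) : ‖1 - q‖ ≤ 1 := by
  have h : star (1 - q) * (1 - q) = 1 - q := by
    rw [star_sub, star_one, hq.1.star_eq]
    simp [mul_sub, sub_mul, hq.2]
  have h2 := CStarRing.norm_star_mul_self (x := 1 - q)
  rw [h] at h2
  nlinarith [norm_nonneg (1 - q)]

theorem approx_aux {a b q : A} (hq : IsProjn q) {δ : ℝ} (hδ : 0 < δ)
    (h : ‖(star a * a + star b * b) - q * (star a * a + star b * b)‖ < δ ^ 2) :
    ‖a * (1 - q)‖ ≤ δ := by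
  let _ := CStarAlgebra.spectralOrder A
  have := CStarAlgebra.spectralOrderedRing A
  have hs : star (1 - q) = 1 - q := by rw [star_sub, star_one, hq.1.star_eq]
  have h1 : star (a * (1 - q)) * (a * (1 - q)) ≤
      (1 - q) * (star a * a + star b * b) * (1 - q) := by
    have : (1 - q) * (star a * a + star b * b) * (1 - q) =
        star (a * (1 - q)) * (a * (1 - q)) + star (b * (1 - q)) * (b * (1 - q)) := by
      rw [star_mul, star_mul, hs]; noncomm_ring
    rw [this]
    exact le_add_of_nonneg_right (star_mul_self_nonneg _)
  have h2 := CStarAlgebra.norm_le_norm_of_nonneg_of_le (star_mul_self_nonneg _) h1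
  rw [CStarRing.norm_star_mul_self] at h2
  have h3 : (1 - q) * (star a * a + star b * b) =
    (star a * a + star b * b) - q * (star a * a + star b * b) := by rw [sub_mul, one_mul]
  have h4 := norm_mul_le ((1 - q) * (star a * a + star b * b)) (1 - q)
  have h5 := projn_one_sub_norm hq
  rw [h3] at h4 h2
  have h6 := norm_nonneg ((star a * a + star b * b) - q * (star a * a + star b * b))
  have h7 : ‖a * (1 - q)‖ ^ 2 ≤ δ ^ 2 := by nlinarith
  exact (pow_le_pow_iff_left₀ (norm_nonneg _) hδ.le two_ne_zero).1 h7

theorem approx_two (J : FiniteTypeIdeal A) {a b : A} (ha : a ∈ J.carrier) (hb : b ∈ J.carrier)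
    {δ : ℝ} (hδ : 0 < δ) :
    ∃ q ∈ J.carrier, IsProjn q ∧ ‖a * (1 - q)‖ ≤ δ ∧ ‖b * (1 - q)‖ ≤ δ := by
  obtain ⟨q, hqJ, hq, h⟩ := J.approx_unit (star a * a + star b * b)
    (J.add_mem (J.mul_left_mem _ ha) (J.mul_left_mem _ hb)) (δ ^ 2) (by positivity)
  refine ⟨q, hqJ, hq, approx_aux hq hδ h, approx_aux (a := b) (b := a) hq hδ ?_⟩
  rwa [add_comm (star b * b)]

/-- Range projection of an idempotent. -/
theorem exists_range_proj {e : A} (he : e * e = e) :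
    ∃ p : A, IsProjn p ∧ p * e = e ∧ e * p = p := by
  let _ := CStarAlgebra.spectralOrder A
  have := CStarAlgebra.spectralOrderedRing A
  have hse : star e * star e = star e := by rw [← star_mul, he]
  obtain ⟨z, hz⟩ : ∃ z, z = 1 + (e - star e) * star (e - star e) := ⟨_, rfl⟩
  have hzs : star z = z := by rw [hz]; simp
  have hu : IsUnit z := by
    refine CStarAlgebra.isUnit_of_le (1 : A) ?_ isStrictlyPositive_one
    rw [hz]
    exact le_add_of_nonneg_right (mul_star_self_nonneg _)
  have hz2 : z = 1 + e * star e - e - star e + star e * e := by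
    rw [hz, star_sub, star_star, sub_mul, mul_sub, mul_sub, he, hse]; abel
  have h1 : e * z = e * star e * e := by
    rw [hz2]; simp only [mul_add, mul_sub, mul_one, ← mul_assoc, he]; abel
  have h2 : z * e = e * star e * e := by
    rw [hz2]; simp only [add_mul, sub_mul, one_mul, mul_assoc, he]; abel
  have hc : Commute e z := by rw [Commute, SemiconjBy, h1, h2]
  have hc' : Commute (star e) z := by
    have := hc.star_star; rwa [hzs] at this
  obtain ⟨w, rfl⟩ := hu
  have k1 : Commute e (↑w⁻¹ : A) := hc.units_inv_right
  have k2 : Commute (star e) (↑w⁻¹ : A) := hc'.units_inv_right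
  have hws : star (↑w⁻¹ : A) = ↑w⁻¹ := by
    have : star w = w := by ext; simpa using hzs
    rw [← Units.coe_star, star_inv, this]
  have hp : e * star e * ↑w⁻¹ * e = e := by
    calc e * star e * ↑w⁻¹ * e = e * star e * (↑w⁻¹ * e) := by noncomm_ring
      _ = e * star e * e * ↑w⁻¹ := by rw [← k1.eq]; noncomm_ring
      _ = e := by rw [← h1, mul_assoc, Units.mul_inv, mul_one]
  refine ⟨e * star e * ↑w⁻¹, ⟨?_, ?_⟩, hp, ?_⟩
  · rw [IsSelfAdjoint, star_mul, star_mul, star_star, hws]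
    exact ((k1.mul_left k2).eq).symm
  · calc e * star e * ↑w⁻¹ * (e * star e * ↑w⁻¹)
        = (e * star e * ↑w⁻¹ * e) * star e * ↑w⁻¹ := by noncomm_ring
      _ = _ := by rw [hp]
  · rw [← mul_assoc, ← mul_assoc, he]

/-- Algebraic equivalence of projections implies Murray–von Neumann equivalence. -/
theorem mvn_of_alg {s t a b : A} (hs : IsProjn s) (ht : IsProjn t) (h1 : b * a = s)
    (h2 : a * b = t) (h3 : t * a = a) (h4 : s * b = b) : MvN s t := by
  let _ := CStarAlgebra.spectralOrder A
  have := CStarAlgebra.spectralOrderedRing A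
  have has : a * s = a := by rw [← h1, ← mul_assoc, h2, h3]
  have hbt : b * t = b := by rw [← h2, ← mul_assoc, h1, h4]
  have hss : star s = s := hs.1.star_eq
  have htt : star t = t := ht.1.star_eq
  have hat : star a * t = star a := by
    have := congrArg star h3; rwa [star_mul, htt] at this
  have hsa : s * star a = star a := by
    have := congrArg star has; rwa [star_mul, hss] at this
  have hbs : star b * s = star b := by
    have := congrArg star h4; rwa [star_mul, hss] at this
  have hab : star a * star b = s := by rw [← star_mul, h1, hss]
  have hba : star b * star a = t := by rw [← star_mul, h2, htt]
  have hpos : 0 ≤ b * star b := mul_star_self_nonneg b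
  obtain ⟨g, hg⟩ : ∃ g, g = CFC.sqrt (b * star b) := ⟨_, rfl⟩
  have hgg : g * g = b * star b := by rw [hg]; exact CFC.sqrt_mul_sqrt_self _ hpos
  have hgs : star g = g := by
    rw [hg]; exact (IsSelfAdjoint.of_nonneg (CFC.sqrt_nonneg _)).star_eq
  have hcomm : Commute (star a * a) (b * star b) := by
    rw [Commute, SemiconjBy]
    calc star a * a * (b * star b) = star a * (a * b) * star b := by noncomm_ring
      _ = s := by rw [h2, hat, hab]
      _ = b * t * a := by rw [hbt, h1]
      _ = b * star b * (star a * a) := by rw [← hba]; noncomm_ring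
  have hcg : Commute g (star a * a) := by
    rw [hg, CFC.sqrt]
    exact Commute.cfcₙ_nnreal hcomm.symm _
  refine ⟨a * g, ?_, ?_⟩
  · have e1 : a * g * star (a * g) = a * b * (star b * star a) := by
      rw [star_mul, hgs]
      calc a * g * (g * star a) = a * (g * g) * star a := by noncomm_ring
        _ = _ := by rw [hgg]; noncomm_ring
    rw [e1, h2, hba, ht.2]
  · rw [star_mul, hgs]
    calc g * star a * (a * g) = g * (star a * a * g) := by noncomm_ring
      _ = g * g * (star a * a) := by rw [← hcg.eq]; noncomm_ring
      _ = b * (star b * star a) * a := by rw [hgg]; noncomm_ring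
      _ = s := by rw [hba, hbt, h1]

theorem mvn_proj {p p' : A} (hp : IsProjn p) (h : MvN p p') : IsProjn p' := by
  obtain ⟨v, rfl, h2⟩ := h
  refine ⟨by simp [IsSelfAdjoint], ?_⟩
  have h3 : v * p = v := by
    have h5 : star (v * (1 - p)) * (v * (1 - p)) = 0 := by
      rw [star_mul, star_sub, star_one, hp.1.star_eq]
      calc (1 - p) * star v * (v * (1 - p)) = (1 - p) * (star v * v) * (1 - p) := by noncomm_ring
        _ = 0 := by rw [h2]; simp [mul_sub, sub_mul, hp.2]
    have h6 := CStarRing.star_mul_self_eq_zero_iff _ |>.1 h5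
    rw [mul_sub, mul_one, sub_eq_zero] at h6
    exact h6.symm
  calc v * star v * (v * star v) = v * (star v * v) * star v := by noncomm_ring
    _ = _ := by rw [h2, h3]

/-- Equivalent projections have isomorphic ranges. -/
theorem mvn_equiv {p p' : A} (h : MvN p p') : Nonempty (Rg p ≃ₗ[Aᵐᵒᵖ] Rg p') := by
  obtain ⟨v, h1, h2⟩ := h
  exact ⟨RgEquiv v (star v) h2 h1⟩

/-- Existence of an orthogonal sum, one step. -/
theorem orth_step (J : FiniteTypeIdeal A) {p s : A} {L : List A} (hp : IsProjn p)
    (hpJ : p ∈ J.carrier) (hs : IsProjn s) (hsJ : s ∈ J.carrier) (hL : OrthSumList L s) :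
    ∃ s', IsProjn s' ∧ s' ∈ J.carrier ∧ OrthSumList (p :: L) s' ∧
      Nonempty (Rg s' ≃ₗ[Aᵐᵒᵖ] (Rg p × Rg s)) := by
  obtain ⟨v, h1, h2, h3⟩ := J.orth_exists s p hsJ hpJ hs hp
  have hm : MvN p (star v * v) := ⟨star v, by simp, by simpa using h1⟩
  have hp' := mvn_proj hp hm
  have h4 : s * (star v * v) = 0 := by
    have := congrArg star h2
    rwa [star_mul, hp'.1.star_eq, hs.1.star_eq, star_zero] at this
  obtain ⟨e⟩ := mvn_equiv hm
  have hJ' : star v * v ∈ J.carrier := by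
    have : star v * v = star v * p * v := by
      rw [← h1]
      calc star v * v = star v * v * (star v * v) := hp'.2.symm
        _ = _ := by noncomm_ring
    rw [this]
    exact J.mul_right_mem _ (J.mul_left_mem _ hpJ)
  refine ⟨star v * v + s, h3, J.add_mem hJ' hsJ, OrthSumList.cons hm hL h2, ⟨?_⟩⟩
  exact (RgSum hp'.2 hs.2 h2 h4).trans (LinearEquiv.prodCongr e.symm (LinearEquiv.refl _ _))

theorem orth_four (J : FiniteTypeIdeal A) {p1 p2 p3 p4 : A} (h1 : IsProjn p1) (h2 : IsProjn p2)
    (h3 : IsProjn p3) (h4 : IsProjn p4) (j1 : p1 ∈ J.carrier) (j2 : p2 ∈ J.carrier)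
    (j3 : p3 ∈ J.carrier) (j4 : p4 ∈ J.carrier) :
    ∃ s, IsProjn s ∧ OrthSumList [p1, p2, p3, p4] s ∧
      Nonempty (Rg s ≃ₗ[Aᵐᵒᵖ] (Rg p1 × Rg p2 × Rg p3 × Rg p4)) := by
  have h0 : IsProjn (0 : A) := ⟨by simp [IsSelfAdjoint], by simp⟩
  obtain ⟨s4, a4, b4, c4, ⟨e4⟩⟩ := orth_step J h4 j4 h0 J.zero_mem OrthSumList.nil
  obtain ⟨s3, a3, b3, c3, ⟨e3⟩⟩ := orth_step J h3 j3 a4 b4 c4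
  obtain ⟨s2, a2, b2, c2, ⟨e2⟩⟩ := orth_step J h2 j2 a3 b3 c3
  obtain ⟨s1, a1, b1, c1, ⟨e1⟩⟩ := orth_step J h1 j1 a2 b2 c2
  have e0 : (Rg p4 × Rg (0 : A)) ≃ₗ[Aᵐᵒᵖ] Rg p4 :=
    { toFun := fun x => x.1
      invFun := fun x => (x, 0)
      map_add' := fun _ _ => rfl
      map_smul' := fun _ _ => rfl
      left_inv := fun x => by
        have hx : (0 : A) * x.2.1 = x.2.1 := x.2.2
        rw [zero_mul] at hx
        refine Prod.ext rfl (Subtype.ext ?_)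
        exact hx
      right_inv := fun _ => rfl }
  refine ⟨s1, a1, c1, ⟨?_⟩⟩
  refine e1.trans (LinearEquiv.prodCongr (LinearEquiv.refl _ _) ?_)
  refine e2.trans (LinearEquiv.prodCongr (LinearEquiv.refl _ _) ?_)
  refine e3.trans (LinearEquiv.prodCongr (LinearEquiv.refl _ _) ?_)
  exact e4.trans e0

/-- Extraction of algebraic data from a diagonal decomposition. -/
theorem decomp_data {F f1 f2 : A} (h : HasDiagDecomp F f1 f2) :
    ∃ G n n' : A, n * n = n ∧ n' * n' = n' ∧ G * F = 1 - n ∧ F * G = 1 - n' ∧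
      n * G = 0 ∧ G * n' = 0 ∧ f1 * n = n ∧ n * f1 = f1 ∧ f2 * n' = n' ∧ n' * f2 = f2 ∧
      IsProjn f1 ∧ IsProjn f2 := by
  obtain ⟨M1, N1, M2, N2, hM1, hN1, hM2, hN2, hc1, hc2, ⟨hmaps, hsurj, c, hc, hbd⟩, hFN, ⟨p1, p2, p3⟩,
    ⟨q1, q2, q3⟩⟩ := h
  have key : ∀ M N : Set A, IsClosedSubmodule M → IsClosedSubmodule N → IsComplPair M N →
      ∃ n ∈ N, 1 - n ∈ M ∧ (∀ x ∈ M, n * x = 0) ∧ (∀ x ∈ N, n * x = x) := by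
    intro M N hM hN hc
    obtain ⟨_, _, hMa, hMm, hMn, _⟩ := hM
    obtain ⟨_, _, hNa, hNm, hNn, _⟩ := hN
    obtain ⟨m, hm, n, hn, h1⟩ := hc.2 1
    have hmn : 1 - n = m := by rw [h1]; abel
    refine ⟨n, hn, by rwa [hmn], ?_, ?_⟩
    · intro x hx
      have e : n * x = x + -(m * x) := by rw [← hmn, sub_mul]; simp
      exact hc.1 ⟨by rw [e]; exact hMa _ hx _ (hMn _ (hMm _ hm _)), hNm _ hn _⟩
    · intro x hx
      have e : m * x = x + -(n * x) := by rw [← hmn, sub_mul]; simp [sub_eq_add_neg]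
      have : m * x = 0 := hc.1 ⟨hMm _ hm _, by rw [e]; exact hNa _ hx _ (hNn _ (hNm _ hn _))⟩
      rw [this] at e
      exact (eq_neg_iff_add_eq_zero.2 e.symm).trans (neg_neg _) |>.symm
  obtain ⟨n, hn, hmn, hn0, hn1⟩ := key M1 N1 hM1 hN1 hc1
  obtain ⟨n', hn', hmn', hn0', hn1'⟩ := key M2 N2 hM2 hN2 hc2
  obtain ⟨G, hG, hFG⟩ := hsurj _ hmn'
  have inj : ∀ x ∈ M1, F * x = 0 → x = 0 := by
    intro x hx h0
    have := hbd x hx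
    rw [h0, norm_zero] at this
    have h2 : ‖x‖ ≤ 0 := by
      by_contra hh
      push Not at hh
      nlinarith [mul_pos hc hh]
    exact norm_le_zero_iff.1 h2
  obtain ⟨_, _, hMa, hMm, hMn, _⟩ := hM1
  have hnn : n * n = n := hn1 n hn
  have hnn' : n' * n' = n' := hn1' n' hn'
  have hGn : G * n' = 0 := by
    apply inj _ (hMm _ hG _)
    rw [← mul_assoc, hFG, sub_mul, hnn']; simp
  have hFn : n' * F = F * n := by
    have a1 : n' * (F * n) = F * n := hn1' _ (hFN _ hn)
    have a2 : n' * (F * (1 - n)) = 0 := hn0' _ (hmaps _ hmn)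
    rw [mul_sub, mul_sub, a1, sub_eq_zero, mul_one] at a2
    exact a2
  have hGF : G * F = 1 - n := by
    have : G * F + -(1 - n) = 0 := by
      apply inj _ (hMa _ (hMm _ hG _) _ (hMn _ hmn))
      rw [mul_add, ← mul_assoc, hFG, sub_mul, hFn]; noncomm_ring
    exact (eq_neg_of_add_eq_zero_left this).trans (neg_neg _)
  refine ⟨G, n, n', hnn, hnn', hGF, hFG, hn0 _ hG, hGn, ?_, ?_, ?_, ?_, ⟨p1, p2⟩, ⟨q1, q2⟩⟩
  · rw [p3] at hn; exact hn
  · apply hn1; rw [p3]; exact p2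
  · rw [q3] at hn'; exact hn'
  · apply hn1'; rw [q3]; exact q2

theorem closedSub_ker (n : A) : IsClosedSubmodule {x : A | n * x = 0} := by
  refine ⟨isClosed_eq (by fun_prop) (by fun_prop), by simp, ?_, ?_, ?_, ?_⟩
  · intro x hx y hy
    simp only [Set.mem_ofPred_eq] at *
    rw [mul_add, hx, hy, add_zero]
  · intro x hx a
    simp only [Set.mem_ofPred_eq] at *
    rw [← mul_assoc, hx, zero_mul]
  · intro x hx
    simp only [Set.mem_ofPred_eq] at *
    rw [mul_neg, hx, neg_zero]
  · intro x hx c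
    simp only [Set.mem_ofPred_eq] at *
    rw [mul_smul_comm, hx, smul_zero]

theorem closedSub_fix (n : A) : IsClosedSubmodule {x : A | n * x = x} := by
  have : {x : A | n * x = x} = {x : A | (n - 1) * x = 0} := by
    ext x; simp [sub_mul, sub_eq_zero]
  rw [this]
  exact closedSub_ker _

theorem compl_pair {n : A} (hn : n * n = n) :
    IsComplPair {x : A | n * x = 0} {x : A | n * x = x} := by
  refine ⟨?_, ?_⟩
  · rintro x ⟨h1, h2⟩
    simp only [Set.mem_ofPred_eq] at h1 h2
    rw [h1] at h2
    exact h2.symm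
  · intro x
    refine ⟨x - n * x, ?_, n * x, ?_, by abel⟩
    · simp only [Set.mem_ofPred_eq]
      rw [mul_sub, ← mul_assoc, hn, sub_self]
    · simp only [Set.mem_ofPred_eq]
      rw [← mul_assoc, hn]

/-- Building a diagonal decomposition from algebraic data. -/
theorem decomp_of_data {T S n n' c c' : A} (hn : n * n = n) (hn' : n' * n' = n')
    (hST : S * T = 1 - n) (hTS : T * S = 1 - n') (hnS : n * S = 0)
    (hc : IsProjn c) (hc' : IsProjn c') (h1 : c * n = n) (h2 : n * c = c)
    (h3 : c' * n' = n') (h4 : n' * c' = c') : HasDiagDecomp T c c' := by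
  have hTn : n' * T = T * n := by
    have e1 : n = 1 - S * T := by rw [hST]; abel
    have e2 : n' = 1 - T * S := by rw [hTS]; abel
    rw [e1, e2]; noncomm_ring
  have fixeq : ∀ {c n : A}, c * n = n → n * c = c → {x : A | n * x = x} = {x : A | c * x = x} := by
    intro c n h1 h2
    ext x
    simp only [Set.mem_ofPred_eq]
    constructor
    · intro h; rw [← h, ← mul_assoc, h1]
    · intro h; rw [← h, ← mul_assoc, h2]
  refine ⟨_, _, _, _, closedSub_ker n, closedSub_fix n, closedSub_ker n', closedSub_fix n',
    compl_pair hn, compl_pair hn', ⟨?_, ?_, ?_⟩, ?_, ⟨hc.1, hc.2, fixeq h1 h2⟩,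
    ⟨hc'.1, hc'.2, fixeq h3 h4⟩⟩
  · intro x hx
    simp only [Set.mem_ofPred_eq] at *
    rw [← mul_assoc, hTn, mul_assoc, hx, mul_zero]
  · intro y hy
    simp only [Set.mem_ofPred_eq] at hy
    refine ⟨S * y, ?_, ?_⟩
    · simp only [Set.mem_ofPred_eq]
      rw [← mul_assoc, hnS, zero_mul]
    · rw [← mul_assoc, hTS, sub_mul, hy]; simp
  · refine ⟨1 / (‖S‖ + 1), by positivity, ?_⟩
    intro x hx
    simp only [Set.mem_ofPred_eq] at hx
    have e : S * (T * x) = x := by rw [← mul_assoc, hST, sub_mul, hx]; simp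
    have e2 := norm_mul_le S (T * x)
    rw [e] at e2
    rw [div_mul_eq_mul_div, one_mul, div_le_iff₀ (by positivity)]
    nlinarith [norm_nonneg (T * x)]
  · intro x hx
    simp only [Set.mem_ofPred_eq] at *
    rw [← mul_assoc, hTn, mul_assoc, hx]

theorem mem_of_equiv (J : FiniteTypeIdeal A) {y n q n' : A} (hy : y * y = y)
    (hq : q ∈ J.carrier) (hn' : n' ∈ J.carrier) (hqq : q * q = q) (hnn : n' * n' = n')
    (φ : (Rg y × Rg n) ≃ₗ[Aᵐᵒᵖ] (Rg q × Rg n')) : y ∈ J.carrier := by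
  obtain ⟨α, hα⟩ : ∃ α, α = φ (⟨y, hy⟩, 0) := ⟨_, rfl⟩
  have a1 : q * α.1.1 = α.1.1 := α.1.2
  have a2 : n' * α.2.1 = α.2.1 := α.2.2
  have hd : α = MulOpposite.op α.1.1 • ((⟨q, hqq⟩, 0) : Rg q × Rg n') +
      MulOpposite.op α.2.1 • ((0, ⟨n', hnn⟩) : Rg q × Rg n') := by
    refine Prod.ext (Subtype.ext ?_) (Subtype.ext ?_)
    · simp [a1]
    · simp [a2]
  have h := congrArg φ.symm hd
  rw [map_add, map_smul, map_smul] at h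
  nth_rewrite 1 [hα] at h
  rw [LinearEquiv.symm_apply_apply] at h
  have h2 := congrArg (fun x => x.1.1) h
  simp only [Prod.fst_add, Prod.smul_fst, Submodule.coe_add, Submodule.coe_smul,
    MulOpposite.smul_eq_mul_unop, MulOpposite.unop_op] at h2
  rw [h2]
  refine J.add_mem (J.mul_left_mem _ ?_) (J.mul_left_mem _ ?_)
  · rw [← a1]; exact J.mul_right_mem _ hq
  · rw [← a2]; exact J.mul_right_mem _ hn'

theorem exists_inv {x : A} (h : ‖x‖ < 1) : ∃ v : A, (1 - x) * v = 1 ∧ v * (1 - x) = 1 := by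
  obtain ⟨u, hu⟩ := isUnit_one_sub_of_norm_lt_one h
  exact ⟨(↑u⁻¹ : A), by rw [← hu]; simp, by rw [← hu]; simp⟩

end CStar

/-- if `F, D ∈ MKΦ(A)` then `DF ∈ MKΦ(A)` and
`index (DF) = index D + index F` in `K(F)`. -/
theorem stmt_12 {A : Type*} [CStarAlgebra A] (Fc : FiniteTypeIdeal A) (F D f1 f2 d1 d2 : A)
    (hF : MKPhi Fc F f1 f2) (hD : MKPhi Fc D d1 d2) :
    ∃ c1 c2 : A, MKPhi Fc (D * F) c1 c2 ∧
      KEqList Fc.carrier [c1, d2, f2] [c2, d1, f1] := by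
  obtain ⟨hF, jf1, jf2⟩ := hF
  obtain ⟨hD, jd1, jd2⟩ := hD
  obtain ⟨G, n, n', hn, hn', hGF, hFG, hnG, hGn, hf1, hf1', hf2, hf2', pf1, pf2⟩ := decomp_data hF
  obtain ⟨K, k, k', hk, hk', hKD, hDK, hkK, hKk, hd1, hd1', hd2, hd2', pd1, pd2⟩ := decomp_data hD
  have jn : n ∈ Fc.carrier := by rw [← hf1]; exact Fc.mul_right_mem _ jf1
  have jn' : n' ∈ Fc.carrier := by rw [← hf2]; exact Fc.mul_right_mem _ jf2
  have jk : k ∈ Fc.carrier := by rw [← hd1]; exact Fc.mul_right_mem _ jd1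
  have jk' : k' ∈ Fc.carrier := by rw [← hd2]; exact Fc.mul_right_mem _ jd2
  -- choose `q`
  obtain ⟨C, hC⟩ : ∃ C, C = 2 * ‖(1 : A)‖ * ‖G‖ := ⟨_, rfl⟩
  have hC0 : 0 ≤ C := by rw [hC]; positivity
  obtain ⟨q, jq, pq, hq1, hq2⟩ := approx_two Fc jn (Fc.mul_right_mem F jk)
    (δ := 1 / (C + 2)) (by positivity)
  have hδ : 1 / (C + 2) ≤ 1 / 2 := by
    apply one_div_le_one_div_of_le <;> linarith
  obtain ⟨v, huv, hvu⟩ := exists_inv (x := n * (1 - q)) (by linarith)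
  have hv : ‖v‖ ≤ 2 * ‖(1 : A)‖ := by
    have e : v = 1 + n * (1 - q) * v := by
      rw [sub_mul, one_mul, sub_eq_iff_eq_add] at huv
      exact huv
    have e1 := norm_add_le (1 : A) (n * (1 - q) * v)
    rw [← e] at e1
    have e2 := norm_mul_le (n * (1 - q)) v
    nlinarith [norm_nonneg v]
  obtain ⟨y, hy1, hyy, hyL, ⟨φ⟩⟩ := core_lemma hn hn' hGF hFG hnG hGn pq.2 huv hvu
  have hky : ‖k * (1 - y)‖ < 1 := by
    have e : k * (1 - y) = k * F * (1 - q) * (v * G) := by rw [← hy1]; noncomm_ring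
    rw [e]
    have e1 := norm_mul_le (k * F * (1 - q)) (v * G)
    have e2 : ‖v * G‖ ≤ C := by
      refine (norm_mul_le v G).trans ?_
      rw [hC]
      exact mul_le_mul_of_nonneg_right hv (norm_nonneg _)
    have e3 : ‖k * F * (1 - q)‖ * ‖v * G‖ ≤ 1 / (C + 2) * C :=
      mul_le_mul hq2 e2 (norm_nonneg _) (by positivity)
    have e4 : 1 / (C + 2) * C < 1 := by
      rw [div_mul_eq_mul_div, one_mul, div_lt_one (by positivity)]; linarith
    linarith
  obtain ⟨w, huw, hwu⟩ := exists_inv hky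
  obtain ⟨z, hz1, hzz, hzL, ⟨ψ⟩⟩ := core_lemma hk hk' hKD hDK hkK hKk hyy huw hwu
  have jy : y ∈ Fc.carrier := mem_of_equiv Fc hyy jq jn' pq.2 hn' φ
  have jz : z ∈ Fc.carrier := mem_of_equiv Fc hzz jy jk' hyy hk' ψ
  obtain ⟨S, hS⟩ : ∃ S, S = (1 - q) * v * G * ((1 - y) * w * K) := ⟨_, rfl⟩
  have hyq : (1 - y) * (F * (1 - q)) = F * (1 - q) := by
    calc (1 - y) * (F * (1 - q)) = F * ((1 - q) * v * G * (F * (1 - q))) := by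
          rw [← hy1]; noncomm_ring
      _ = F * ((1 - q)) := by rw [hyL]
  have hqq : (1 - q) * (1 - q) = 1 - q := by simp [mul_sub, sub_mul, pq.2]
  have hyy' : (1 - y) * (1 - y) = 1 - y := by simp [mul_sub, sub_mul, hyy]
  have hSq : S * (D * F) * (1 - q) = 1 - q := by
    calc S * (D * F) * (1 - q) = S * D * (F * (1 - q)) := by noncomm_ring
      _ = S * D * ((1 - y) * (F * (1 - q))) := by rw [hyq]
      _ = (1 - q) * v * G * (((1 - y) * w * K * (D * (1 - y))) * (F * (1 - q))) := by
          rw [hS]; noncomm_ring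
      _ = 1 - q := by rw [hzL, hyq, hyL]
  have hTS : D * F * S = 1 - z := by
    calc D * F * S = D * (F * (1 - q) * v * G) * ((1 - y) * w * K) := by
          rw [hS]; noncomm_ring
      _ = D * ((1 - y) * (1 - y)) * w * K := by rw [hy1]; noncomm_ring
      _ = 1 - z := by rw [hyy', hz1]
  have hqS : q * S = 0 := by
    have : q * (1 - q) = 0 := by rw [mul_sub, pq.2]; simp
    rw [hS]; simp only [← mul_assoc, this, zero_mul]
  obtain ⟨ν, hν⟩ : ∃ ν, ν = 1 - S * (D * F) := ⟨_, rfl⟩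
  have hqν : q * ν = q := by rw [hν, mul_sub, ← mul_assoc, hqS]; simp
  have hνq : ν * q = ν := by
    have : ν * (1 - q) = 0 := by rw [hν, sub_mul, hSq, one_mul, sub_self]
    rw [mul_sub, mul_one, sub_eq_zero] at this
    exact this.symm
  have hνν : ν * ν = ν := by
    nth_rewrite 1 [← hνq]
    rw [mul_assoc, hqν, hνq]
  have hST : S * (D * F) = 1 - ν := by rw [hν]; abel
  have hνS : ν * S = 0 := by rw [← hνq, mul_assoc, hqS, mul_zero]
  have jν : ν ∈ Fc.carrier := by rw [← hνq]; exact Fc.mul_left_mem _ jq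
  obtain ⟨c1, pc1, hc1, hc1'⟩ := exists_range_proj hνν
  obtain ⟨c2, pc2, hc2, hc2'⟩ := exists_range_proj hzz
  obtain ⟨r, pr, hr, hr'⟩ := exists_range_proj hyy
  have jc1 : c1 ∈ Fc.carrier := by rw [← hc1']; exact Fc.mul_right_mem _ jν
  have jc2 : c2 ∈ Fc.carrier := by rw [← hc2']; exact Fc.mul_right_mem _ jz
  have jr : r ∈ Fc.carrier := by rw [← hr']; exact Fc.mul_right_mem _ jy
  refine ⟨c1, c2, ⟨decomp_of_data hνν hzz hST hTS hνS pc1 pc2 hc1 hc1' hc2 hc2', jc1, jc2⟩, ?_⟩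
  obtain ⟨s, ps, hs, ⟨es⟩⟩ := orth_four Fc pc1 pd2 pf2 pr jc1 jd2 jf2 jr
  obtain ⟨t, pt, ht, ⟨et⟩⟩ := orth_four Fc pc2 pd1 pf1 pr jc2 jd1 jf1 jr
  refine ⟨r, s, t, pr, jr, hs, ht, ?_⟩
  have ec1 : Rg c1 ≃ₗ[Aᵐᵒᵖ] Rg q :=
    (RgEquiv ν c1 hc1 hc1' : Rg ν ≃ₗ[Aᵐᵒᵖ] Rg c1).symm.trans (RgEquiv q ν hνq hqν)
  have same : ∀ {e p : A}, p * e = e → e * p = p → Nonempty (Rg p ≃ₗ[Aᵐᵒᵖ] Rg e) := by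
    intro e p h1 h2
    exact ⟨RgEquiv p e h2 h1⟩
  obtain ⟨ec2⟩ := same hc2 hc2'
  obtain ⟨er⟩ := same hr hr'
  obtain ⟨ef1⟩ := same hf1 hf1'
  obtain ⟨ef2⟩ := same hf2 hf2'
  obtain ⟨ed1⟩ := same hd1 hd1'
  obtain ⟨ed2⟩ := same hd2 hd2'
  have E1 : (Rg c1 × Rg d2 × Rg f2 × Rg r) ≃ₗ[Aᵐᵒᵖ] (Rg q × Rg k' × Rg n' × Rg y) :=
    LinearEquiv.prodCongr ec1 (LinearEquiv.prodCongr ed2 (LinearEquiv.prodCongr ef2 er))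
  have E2 : (Rg c2 × Rg d1 × Rg f1 × Rg r) ≃ₗ[Aᵐᵒᵖ] (Rg z × Rg k × Rg n × Rg y) :=
    LinearEquiv.prodCongr ec2 (LinearEquiv.prodCongr ed1 (LinearEquiv.prodCongr ef1 er))
  have E3 : (Rg z × Rg k × Rg n × Rg y) ≃ₗ[Aᵐᵒᵖ] ((Rg z × Rg k) × (Rg y × Rg n)) :=
    { toFun := fun x => ((x.1, x.2.1), (x.2.2.2, x.2.2.1))
      invFun := fun x => (x.1.1, x.1.2, x.2.2, x.2.1)
      map_add' := fun _ _ => rfl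
      map_smul' := fun _ _ => rfl
      left_inv := fun _ => rfl
      right_inv := fun _ => rfl }
  have E4 : ((Rg y × Rg k') × (Rg q × Rg n')) ≃ₗ[Aᵐᵒᵖ] (Rg q × Rg k' × Rg n' × Rg y) :=
    { toFun := fun x => (x.2.1, x.1.2, x.2.2, x.1.1)
      invFun := fun x => ((x.2.2.2, x.2.1), (x.1, x.2.2.1))
      map_add' := fun _ _ => rfl
      map_smul' := fun _ _ => rfl
      left_inv := fun _ => rfl
      right_inv := fun _ => rfl }
  have E5 := (E3.trans (LinearEquiv.prodCongr ψ φ)).trans E4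
  have E6 : Rg s ≃ₗ[Aᵐᵒᵖ] Rg t := ((es.trans E1).trans E5.symm).trans (E2.symm.trans et.symm)
  obtain ⟨a, b, h1, h2, h3, h4⟩ := alg_of_equiv ps.2 pt.2 E6
  exact mvn_of_alg ps pt h1 h2 h3 h4
end

section
/- If F ∈ MKΦ(A) and K ∈ F (a finite type element), then F + K ∈ MKΦ(A) and index(F + K) = index(F). -/
section Helpers

/-- A projection with the same range as a given idempotent. -/
theorem exists_projn_of_idem {A : Type*} [CStarAlgebra A] (e : A) (he : e * e = e) :
    ∃ p : A, IsProjn p ∧ p * e = e ∧ e * p = p := by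
  let _ : PartialOrder A := CStarAlgebra.spectralOrder A
  have _ : StarOrderedRing A := CStarAlgebra.spectralOrderedRing A
  have hes : star e * star e = star e := by rw [← star_mul, he]
  set z : A := 1 + star (star e - e) * (star e - e) with hz
  have hzz : z = 1 + e * star e - e - star e + star e * e := by
    rw [hz, star_sub, star_star, sub_mul, mul_sub, mul_sub, he, hes]; abel
  have hu : IsUnit z := by
    have h1 : IsUnit (1 : A) := isUnit_one
    refine CStarAlgebra.isUnit_of_le (1 : A) ?_
    rw [hz]
    exact le_add_of_nonneg_right (star_mul_self_nonneg _)
  obtain ⟨U, hU⟩ := hu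
  have hez : e * z = e * star e * e := by
    rw [hzz]; simp only [mul_add, mul_sub, mul_one, ← mul_assoc, he]; abel
  have hze : z * e = e * star e * e := by
    rw [hzz]; simp only [add_mul, sub_mul, one_mul, mul_assoc, he]; abel
  have hsz : star z = z := by rw [hz]; simp
  have hcomm : Commute z e := by rw [Commute, SemiconjBy, hez, hze]
  have hcomm' : Commute z (star e) := by
    have := hcomm.star_star; rwa [hsz] at this
  have hc1 : Commute (↑U⁻¹ : A) e := by
    rw [← hU] at hcomm; exact hcomm.units_inv_left
  have hc2 : Commute (↑U⁻¹ : A) (star e) := by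
    rw [← hU] at hcomm'; exact hcomm'.units_inv_left
  have hsU : star (↑U⁻¹ : A) = ↑U⁻¹ := by
    have : star U = U := by ext; simp [hU, hsz]
    rw [← Units.coe_star_inv, this]
  have hpe : e * star e * ↑U⁻¹ * e = e := by
    rw [mul_assoc, hc1.eq, ← mul_assoc, ← hez, ← hU, mul_assoc, Units.mul_inv, mul_one]
  refine ⟨e * star e * ↑U⁻¹, ⟨?_, ?_⟩, hpe, ?_⟩
  · rw [IsSelfAdjoint, star_mul, star_mul, star_star, hsU]
    exact (hc1.mul_right hc2).eq
  · rw [← mul_assoc, ← mul_assoc, hpe]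
  · rw [← mul_assoc, ← mul_assoc, he]

/-- Algebraically equivalent projections are Murray–von Neumann equivalent. -/
theorem mvN_of_alg {A : Type*} [CStarAlgebra A] (s t a b : A) (hs : IsProjn s) (ht : IsProjn t)
    (hab : a * b = s) (hba : b * a = t) : MvN s t := by
  let _ : PartialOrder A := CStarAlgebra.spectralOrder A
  have _ : StarOrderedRing A := CStarAlgebra.spectralOrderedRing A
  wlog hn : s * a = a ∧ a * t = a ∧ b * s = b ∧ t * b = b generalizing a b
  · refine this (s * a * t) (t * b * s) ?_ ?_ ?_
    · have : s * a * t * (t * b * s) = s * (a * b) * (a * b) * s := by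
        rw [← hba]
        have h2 : b * a * (b * a) = b * a := by rw [hba]; exact ht.2
        calc s * a * (b * a) * (b * a * b * s) = s * a * (b * a * (b * a)) * b * s := by noncomm_ring
          _ = _ := by rw [h2]; noncomm_ring
      rw [this, hab]; simp only [hs.2]
    · have : t * b * s * (s * a * t) = t * (b * a) * (b * a) * t := by
        rw [← hab]
        have h2 : a * b * (a * b) = a * b := by rw [hab]; exact hs.2
        calc t * b * (a * b) * (a * b * a * t) = t * b * (a * b * (a * b)) * a * t := by noncomm_ring
          _ = _ := by rw [h2]; noncomm_ring
      rw [this, hba]; simp only [ht.2]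
    · refine ⟨?_, ?_, ?_, ?_⟩
      · rw [← mul_assoc, ← mul_assoc, hs.2]
      · rw [mul_assoc, ht.2]
      · rw [mul_assoc, hs.2]
      · rw [← mul_assoc, ← mul_assoc, ht.2]
  obtain ⟨h1, h2, h3, h4⟩ := hn
  have hss : star s = s := hs.1
  have hts : star t = t := ht.1
  set w : A := a * star a + (1 - s) with hw
  have hw0 : 0 ≤ w := by
    rw [hw]
    refine add_nonneg (mul_star_self_nonneg a) ?_
    have : (1 - s) = star (1 - s) * (1 - s) := by
      rw [star_sub, star_one, hss, mul_sub, sub_mul, sub_mul, hs.2]; simp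
    rw [this]; exact star_mul_self_nonneg _
  have hb0 : b * (1 - s) = 0 := by rw [mul_sub, h3, mul_one, sub_self]
  have hb0' : (1 - s) * star b = 0 := by
    have := congrArg star hb0; simpa [hss] using this
  have hbw : star b * b * w = s := by
    calc star b * b * w = star b * (b * a) * star a + star b * (b * (1 - s)) := by
          rw [hw]; noncomm_ring
      _ = star (a * (t * b)) := by rw [hb0, hba, mul_zero, add_zero]; simp [hts, mul_assoc]
      _ = s := by rw [h4, hab, hss]
  have hws : star w = w := by rw [hw]; simp [hss]
  have hwb : w * (star b * b) = s := by
    have := congrArg star hbw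
    simpa [hws, hss] using this
  have hcw : Commute w (star b * b) := by rw [Commute, SemiconjBy, hbw, hwb]
  have hk : CFC.sqrt w * CFC.sqrt w = w := CFC.sqrt_mul_sqrt_self w hw0
  have hks : star (CFC.sqrt w) = CFC.sqrt w := (CFC.sqrt_nonneg w).isSelfAdjoint
  have hck : Commute (CFC.sqrt w) (star b * b) := by
    rw [CFC.sqrt_eq_cfc]
    exact hcw.cfc_nnreal _
  refine ⟨b * CFC.sqrt w, ?_, ?_⟩
  · rw [star_mul, hks, mul_assoc, ← mul_assoc (CFC.sqrt w), hk, hw, add_mul, hb0', add_zero]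
    calc b * (a * star a * star b) = (b * a) * star (b * a) := by rw [star_mul]; noncomm_ring
      _ = t := by rw [hba, hts, ht.2]
  · rw [star_mul, hks]
    calc CFC.sqrt w * star b * (b * CFC.sqrt w) = (CFC.sqrt w * (star b * b)) * CFC.sqrt w := by
          noncomm_ring
      _ = s := by rw [hck.eq, mul_assoc, hk, hbw]

/-- Components of a decomposition are given by an idempotent. -/
theorem exists_idem_of_complPair {A : Type*} [CStarAlgebra A] {M N : Set A}
    (hM : IsClosedSubmodule M) (hN : IsClosedSubmodule N) (h : IsComplPair M N) :
    ∃ e : A, (∀ x ∈ N, e * x = x) ∧ (∀ x ∈ M, e * x = 0) ∧ (∀ x, e * x ∈ N) ∧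
      (∀ x, (1 - e) * x ∈ M) := by
  obtain ⟨m, hm, n, hn, h1⟩ := h.2 1
  obtain ⟨-, -, hMa, hMm, hMn, -⟩ := hM
  obtain ⟨-, -, hNa, hNm, hNn, -⟩ := hN
  have hmn : m = 1 - n := by rw [h1]; abel
  refine ⟨n, ?_, ?_, fun x => hNm _ hn x, fun x => hmn ▸ hMm _ hm x⟩
  · intro x hx
    have e1 : m * x = x + -(n * x) := by rw [hmn, sub_mul, one_mul, sub_eq_add_neg]
    have h0 : m * x = 0 := h.1 ⟨hMm _ hm x, e1 ▸ hNa _ hx _ (hNn _ (hNm _ hn x))⟩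
    rw [h0] at e1
    have := (add_eq_zero_iff_eq_neg.mp e1.symm)
    simpa using this.symm
  · intro x hx
    have e1 : n * x = x + -(m * x) := by rw [hmn, sub_mul, one_mul]; abel
    exact h.1 ⟨e1 ▸ hMa _ hx _ (hMn _ (hMm _ hm x)), hNm _ hn x⟩

/-- Algebraic form of a decomposition. -/
theorem alg_of_decomp {A : Type*} [CStarAlgebra A] {F f1 f2 : A} (h : HasDiagDecomp F f1 f2) :
    IsProjn f1 ∧ IsProjn f2 ∧ ∃ e1 e2 G : A, e1 * e1 = e1 ∧ e2 * e2 = e2 ∧ f1 * e1 = e1 ∧ e1 * f1 = f1 ∧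
      f2 * e2 = e2 ∧ e2 * f2 = f2 ∧ F * G = 1 - e2 ∧ G * F = 1 - e1 ∧ e1 * G = 0 ∧ G * e2 = 0 := by
  obtain ⟨M1, N1, M2, N2, hM1, hN1, hM2, hN2, hc1, hc2, ⟨hF1, hF2, c, hc, hF3⟩, hFN, hp1, hp2⟩ := h
  obtain ⟨e1, a1, a2, a3, a4⟩ := exists_idem_of_complPair hM1 hN1 hc1
  obtain ⟨e2, b1, b2, b3, b4⟩ := exists_idem_of_complPair hM2 hN2 hc2
  have he1 : e1 ∈ N1 := by simpa using a3 1
  have he2 : e2 ∈ N2 := by simpa using b3 1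
  have he1' : 1 - e1 ∈ M1 := by simpa using a4 1
  have he2' : 1 - e2 ∈ M2 := by simpa using b4 1
  obtain ⟨G, hG, hFG⟩ := hF2 _ he2'
  have k1 : e2 * (F * (1 - e1)) = 0 := b2 _ (hF1 _ he1')
  have k2 : e2 * (F * e1) = F * e1 := b1 _ (hFN _ he1)
  have k3 : e2 * F = F * e1 := by
    rw [mul_sub, mul_sub, sub_eq_zero, k2, mul_one] at k1; exact k1
  have inj : ∀ x ∈ M1, F * x = 0 → x = 0 := by
    intro x hx h0
    have := hF3 x hx
    rw [h0, norm_zero] at this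
    have h2 : ‖x‖ ≤ 0 := by
      by_contra hcon
      push Not at hcon
      have := mul_pos hc hcon
      linarith
    exact norm_le_zero_iff.mp h2
  obtain ⟨-, -, hMa, hMm, hMn, -⟩ := hM1
  have hGF : G * F + -(1 - e1) = 0 := by
    refine inj _ (hMa _ (hMm _ hG _) _ (hMn _ he1')) ?_
    rw [mul_add, ← mul_assoc, hFG, mul_neg, sub_mul, k3, mul_sub]; simp
  have q1 : f1 * e1 = e1 := by have := he1; rw [hp1.2.2] at this; exact this
  have q2 : f2 * e2 = e2 := by have := he2; rw [hp2.2.2] at this; exact this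
  refine ⟨⟨hp1.1, hp1.2.1⟩, ⟨hp2.1, hp2.2.1⟩, e1, e2, G, a1 _ he1, b1 _ he2, q1, a1 _ ?_, q2,
    b1 _ ?_, hFG, ?_, a2 _ hG, ?_⟩
  · rw [hp1.2.2]; exact hp1.2.1
  · rw [hp2.2.2]; exact hp2.2.1
  · rw [← sub_eq_zero, sub_eq_add_neg]; exact hGF
  · refine inj _ (hMm _ hG _) ?_
    rw [← mul_assoc, hFG, sub_mul, b1 _ he2, one_mul, sub_self]

theorem closedSub_of_idem {A : Type*} [CStarAlgebra A] (e : A) :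
    IsClosedSubmodule {x : A | e * x = x} := by
  refine ⟨isClosed_eq (by fun_prop) (by fun_prop), by simp, ?_, ?_, ?_, ?_⟩
  · intro x hx y hy; simp only [Set.mem_setOf_eq] at *; rw [mul_add, hx, hy]
  · intro x hx a; simp only [Set.mem_setOf_eq] at *; rw [← mul_assoc, hx]
  · intro x hx; simp only [Set.mem_setOf_eq] at *; rw [mul_neg, hx]
  · intro x hx a; simp only [Set.mem_setOf_eq] at *; rw [mul_smul_comm, hx]

theorem complPair_of_idem {A : Type*} [CStarAlgebra A] (e : A) (he : e * e = e) :
    IsComplPair {x : A | (1 - e) * x = x} {x : A | e * x = x} := by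
  refine ⟨?_, fun x => ⟨(1 - e) * x, ?_, e * x, ?_, ?_⟩⟩
  · rintro x ⟨h1, h2⟩
    simp only [Set.mem_setOf_eq] at h1 h2
    rw [sub_mul, h2, one_mul, sub_self] at h1
    exact h1.symm
  · simp only [Set.mem_setOf_eq]; rw [← mul_assoc, sub_mul, mul_sub, mul_sub, he]; simp
  · simp only [Set.mem_setOf_eq]; rw [← mul_assoc, he]
  · noncomm_ring

/-- Converse of `alg_of_decomp`. -/
theorem decomp_of_alg {A : Type*} [CStarAlgebra A] {F G e1 e2 g1 g2 : A}
    (he1 : e1 * e1 = e1) (he2 : e2 * e2 = e2) (hFG : F * G = 1 - e2) (hGF : G * F = 1 - e1)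
    (hg1 : IsProjn g1) (hg2 : IsProjn g2) (h1 : g1 * e1 = e1) (h2 : e1 * g1 = g1)
    (h3 : g2 * e2 = e2) (h4 : e2 * g2 = g2) : HasDiagDecomp F g1 g2 := by
  have hF : e2 * F = F * e1 := by
    have a : F * G * F = F * (G * F) := mul_assoc _ _ _
    rw [hFG, hGF, sub_mul, mul_sub, one_mul, mul_one] at a
    exact sub_right_injective a
  have hG : e1 * G = G * e2 := by
    have a : G * F * G = G * (F * G) := mul_assoc _ _ _
    rw [hFG, hGF, sub_mul, mul_sub, one_mul, mul_one] at a
    exact sub_right_injective a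
  refine ⟨_, _, _, _, closedSub_of_idem (1 - e1), closedSub_of_idem e1, closedSub_of_idem (1 - e2),
    closedSub_of_idem e2, complPair_of_idem e1 he1, complPair_of_idem e2 he2, ⟨?_, ?_, ?_⟩, ?_,
    ⟨hg1.1, hg1.2, ?_⟩, ⟨hg2.1, hg2.2, ?_⟩⟩
  · intro x hx
    simp only [Set.mem_setOf_eq] at *
    rw [← mul_assoc, sub_mul, hF, one_mul, ← mul_one_sub, mul_assoc, hx]
  · intro y hy
    simp only [Set.mem_setOf_eq] at *
    refine ⟨G * y, ?_, ?_⟩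
    · rw [← mul_assoc, sub_mul, hG, one_mul, ← mul_one_sub, mul_assoc, hy]
    · rw [← mul_assoc, hFG, hy]
  · refine ⟨(‖G‖ + 1)⁻¹, by positivity, ?_⟩
    intro x hx
    simp only [Set.mem_setOf_eq] at hx
    rw [inv_mul_le_iff₀ (by positivity)]
    calc ‖x‖ = ‖G * (F * x)‖ := by rw [← mul_assoc, hGF, hx]
      _ ≤ ‖G‖ * ‖F * x‖ := norm_mul_le _ _
      _ ≤ _ := by gcongr; linarith
  · intro x hx
    simp only [Set.mem_setOf_eq] at *
    rw [← mul_assoc, hF, mul_assoc, hx]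
  · ext x
    simp only [Set.mem_setOf_eq]
    constructor
    · intro h; rw [← h, ← mul_assoc, h1]
    · intro h; rw [← h, ← mul_assoc, h2]
  · ext x
    simp only [Set.mem_setOf_eq]
    constructor
    · intro h; rw [← h, ← mul_assoc, h3]
    · intro h; rw [← h, ← mul_assoc, h4]

/-- Triangular block isomorphisms assemble to an algebraic equivalence. -/
theorem block_equiv {R : Type*} [Ring R] {a1 a2 a3 a4 b1 b2 b3 b4 P1 P2 Q1 Q2
    x11 x21 x22 y11 y12 y22 : R}
    (h11 : b1 * a1 = P1) (h22 : b2 * a2 = P2) (h12 : b1 * a2 = 0) (h21 : b2 * a1 = 0)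
    (n1 : y11 * Q1 = y11) (n2 : y12 * Q2 = y12) (n3 : y22 * Q2 = y22)
    (h33 : b3 * a3 = Q1) (h44 : b4 * a4 = Q2) (h34 : b3 * a4 = 0) (h43 : b4 * a3 = 0)
    (k1 : y11 * x11 + y12 * x21 = P1) (k2 : y12 * x22 = 0) (k3 : y22 * x21 = 0)
    (k4 : y22 * x22 = P2) :
    (a1 * y11 * b3 + a1 * y12 * b4 + a2 * y22 * b4) *
      (a3 * x11 * b1 + a4 * x21 * b1 + a4 * x22 * b2) = a1 * P1 * b1 + a2 * P2 * b2 := by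
  have : (a1 * y11 * b3 + a1 * y12 * b4 + a2 * y22 * b4) *
      (a3 * x11 * b1 + a4 * x21 * b1 + a4 * x22 * b2) =
      a1 * (y11 * (b3 * a3)) * x11 * b1 + a1 * y11 * (b3 * a4) * (x21 * b1 + x22 * b2)
      + (a1 * y12 + a2 * y22) * (b4 * a3) * x11 * b1
      + a1 * (y12 * (b4 * a4)) * x21 * b1 + a1 * (y12 * (b4 * a4)) * x22 * b2
      + a2 * (y22 * (b4 * a4)) * x21 * b1 + a2 * (y22 * (b4 * a4)) * x22 * b2 := by noncomm_ring
  rw [this, h33, h34, h43, h44, n1, n2, n3, ← k1, ← k4]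
  have z1 : a1 * y12 * x22 * b2 = 0 := by rw [mul_assoc a1, k2]; simp
  have z2 : a2 * y22 * x21 * b1 = 0 := by rw [mul_assoc a2, k3]; simp
  rw [z1, z2]; noncomm_ring

theorem block_equiv' {R : Type*} [Ring R] {a1 a2 a3 a4 b1 b2 b3 b4 P1 P2 Q1 Q2
    x11 x21 x22 y11 y12 y22 : R}
    (h11 : b1 * a1 = P1) (h22 : b2 * a2 = P2) (h12 : b1 * a2 = 0) (h21 : b2 * a1 = 0)
    (n1 : x11 * P1 = x11) (n2 : x21 * P1 = x21) (n3 : x22 * P2 = x22)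
    (k1 : x11 * y11 = Q1) (k2 : x11 * y12 = 0) (k3 : x21 * y11 = 0)
    (k4 : x21 * y12 + x22 * y22 = Q2) :
    (a3 * x11 * b1 + a4 * x21 * b1 + a4 * x22 * b2) *
    (a1 * y11 * b3 + a1 * y12 * b4 + a2 * y22 * b4) = a3 * Q1 * b3 + a4 * Q2 * b4 := by
  have : (a3 * x11 * b1 + a4 * x21 * b1 + a4 * x22 * b2) *
    (a1 * y11 * b3 + a1 * y12 * b4 + a2 * y22 * b4) =
      a3 * (x11 * (b1 * a1)) * y11 * b3 + a3 * (x11 * (b1 * a1)) * y12 * b4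
      + a4 * (x21 * (b1 * a1)) * y11 * b3 + a4 * (x21 * (b1 * a1)) * y12 * b4
      + (a3 * x11 + a4 * x21) * (b1 * a2) * y22 * b4
      + a4 * x22 * (b2 * a1) * (y11 * b3 + y12 * b4)
      + a4 * (x22 * (b2 * a2)) * y22 * b4 := by noncomm_ring
  rw [this, h11, h12, h21, h22, n1, n2, n3, ← k1, ← k4]
  have z1 : a3 * x11 * y12 * b4 = 0 := by rw [mul_assoc a3, k2]; simp
  have z2 : a4 * x21 * y11 * b3 = 0 := by rw [mul_assoc a4, k3]; simp
  rw [z1, z2]; noncomm_ring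

/-- Facts on a partial isometry with final projection `p` and initial projection
orthogonal to `q`. -/
theorem partial_iso_facts {A : Type*} [CStarAlgebra A] {v p q : A} (hp : IsProjn p) (hq : IsProjn q)
    (h1 : v * star v = p) (h2 : star v * v * q = 0) :
    p * v = v ∧ v * q = 0 ∧ q * star v = 0 := by
  have hpv : p * v = v := by
    have h0 : (p * v - v) * star (p * v - v) = 0 := by
      have : (p * v - v) * star (p * v - v) =
        p * (v * star v) * star p - p * (v * star v) - (v * star v) * star p + v * star v := by
        rw [star_sub, star_mul]; noncomm_ring
      have hps : star p = p := hp.1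
      rw [this, h1, hps, hp.2, hp.2]; simp
    rw [CStarRing.mul_star_self_eq_zero_iff] at h0
    exact sub_eq_zero.mp h0
  have hvq : v * q = 0 := by
    calc v * q = (v * star v) * v * q := by rw [h1, hpv]
      _ = v * (star v * v * q) := by noncomm_ring
      _ = 0 := by rw [h2, mul_zero]
  refine ⟨hpv, hvq, ?_⟩
  have := congrArg star hvq
  have hqs : star q = q := hq.1
  simpa [hqs] using this

/-- The ring-theoretic core. -/
theorem core_ring {R : Type*} [Ring R] {F F' G e1 e2 q u ui H e c : R}
    (he1 : e1 * e1 = e1) (hq : q * q = q)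
    (hFG : F * G = 1 - e2) (hGF : G * F = 1 - e1) (heG : e1 * G = 0) (hGe : G * e2 = 0)
    (hu : u = (1 - q) * F' * G + q) (hui : u * ui = 1) (hiu : ui * u = 1)
    (hqu : q * u = q) (hH : H = G * ui * (1 - q)) (he : e = 1 - H * F') (hc : c = e * (1 - e1)) :
    ((1 - q) * F' * H = 1 - q) ∧ e * e = e ∧ e1 * e = e1 ∧ (e * G * q = e * G) ∧
    (e * e1 * e1 + e * G * (q * F * c) = e) ∧
    (e * G * (q * e2) = 0) ∧ (e2 * ui * q * (q * F * c) = 0) ∧ (e2 * ui * q * (q * e2) = e2) ∧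
    (e1 * (e * e1) = e1) ∧ (e1 * (e * G) = 0) ∧ (q * F * c * (e * e1) = 0) ∧
    (q * F * c * (e * G) + q * e2 * (e2 * ui * q) = q) ∧ c * e = c := by
  have hqui : q * ui = q := by
    calc q * ui = q * u * ui := by rw [hqu]
      _ = q := by rw [mul_assoc, hui, mul_one]
  have hT : (1 - q) * F' * G = u - q := by rw [hu]; abel
  have s1 : (1 - q) * F' * H = 1 - q := by
    calc (1 - q) * F' * H = ((1 - q) * F' * G) * ui * (1 - q) := by rw [hH]; noncomm_ring
      _ = (u * ui - q * ui) * (1 - q) := by rw [hT]; noncomm_ring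
      _ = 1 - q := by rw [hui, hqui]; simp only [mul_sub, sub_mul, hq]; simp
  have hqq : (1 - q) * (1 - q) = 1 - q := by simp only [mul_sub, sub_mul, hq]; simp
  have hHq : H * (1 - q) = H := by rw [hH, mul_assoc, hqq]
  have hHFH : H * F' * H = H := by
    calc H * F' * H = H * (1 - q) * F' * H := by rw [hHq]
      _ = H * ((1 - q) * F' * H) := by noncomm_ring
      _ = H := by rw [s1, hHq]
  have heH : e * H = 0 := by rw [he, sub_mul, hHFH]; simp
  have s2 : e * e = e := by
    calc e * e = e - e * H * F' := by nth_rw 2 [he]; noncomm_ring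
      _ = e := by rw [heH]; simp
  have he1H : e1 * H = 0 := by rw [hH, ← mul_assoc, ← mul_assoc, heG]; simp
  have s3 : e1 * e = e1 := by rw [he, mul_sub, ← mul_assoc, he1H]; simp
  have heGu : e * G * ui = e * G * ui * q := by
    have : e * G * ui * (1 - q) = 0 := by rw [← heH, hH]; noncomm_ring
    rw [mul_sub, mul_one, sub_eq_zero] at this; exact this
  have heGq' : e * G = e * G * ui * q := by
    calc e * G = e * G * ui * u := by rw [mul_assoc _ ui, hiu, mul_one]
      _ = e * G * ui * (q * u) := by rw [← mul_assoc (e * G * ui), ← heGu]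
      _ = e * G * ui * q := by rw [hqu]
  have s4 : e * G * q = e * G := by
    rw [heGq', mul_assoc, hq]
  have e1c : e1 * c = 0 := by rw [hc, ← mul_assoc, s3, mul_sub, he1]; simp
  have ce1 : c * e1 = 0 := by rw [hc, mul_assoc, sub_mul, he1]; simp
  have ec : e * c = c := by rw [hc, ← mul_assoc, s2]
  have ce : c * e = c := by
    rw [hc, mul_assoc, sub_mul, s3, mul_sub, mul_sub, one_mul, s2, mul_one]
  have GFc : G * F * c = c := by rw [hGF, sub_mul, e1c]; simp
  have hFe : (1 - q) * F' * e = 0 := by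
    calc (1 - q) * F' * e = (1 - q) * F' - ((1 - q) * F' * H) * F' := by rw [he]; noncomm_ring
      _ = 0 := by rw [s1]; simp
  have e2F : e2 * F = F * e1 := by
    have a : F * G * F = F * (G * F) := mul_assoc _ _ _
    rw [hFG, hGF, sub_mul, mul_sub, one_mul, mul_one] at a
    exact sub_right_injective a
  have uiq : ui * q = 1 - ui * ((1 - q) * F' * G) := by
    rw [hT, mul_sub, hiu]; abel
  have t1 : ui * q * e2 = e2 := by
    calc ui * q * e2 = e2 - ui * ((1 - q) * F') * (G * e2) := by rw [uiq]; noncomm_ring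
      _ = e2 := by rw [hGe]; simp
  have e2e2 : e2 * e2 = e2 := by
    have : e2 = 1 - F * G := by rw [hFG]; abel
    nth_rw 1 [this]
    rw [sub_mul, mul_assoc, hGe]; simp
  refine ⟨s1, s2, s3, s4, ?_, ?_, ?_, ?_, ?_, ?_, ?_, ?_, ce⟩
  · calc e * e1 * e1 + e * G * (q * F * c) = e * (e1 * e1) + (e * G * q) * F * c := by noncomm_ring
      _ = e * e1 + e * (G * F * c) := by rw [s4, he1]; noncomm_ring
      _ = e := by rw [GFc, ec, hc]; noncomm_ring
  · rw [← mul_assoc, s4, mul_assoc, hGe, mul_zero]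
  · calc e2 * ui * q * (q * F * c) = e2 * ui * (q * q) * F * c := by noncomm_ring
      _ = e2 * (ui * q) * F * c := by rw [hq]; noncomm_ring
      _ = (e2 * F) * c - e2 * ui * ((1 - q) * F') * (G * F * c) := by rw [uiq]; noncomm_ring
      _ = F * (e1 * c) - e2 * ui * ((1 - q) * F' * e) * c := by
          rw [GFc, e2F]; nth_rw 2 [← ec]; noncomm_ring
      _ = 0 := by rw [e1c, hFe]; simp
  · calc e2 * ui * q * (q * e2) = e2 * ui * (q * q) * e2 := by noncomm_ring
      _ = e2 * (ui * q * e2) := by rw [hq]; noncomm_ring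
      _ = e2 := by rw [t1, e2e2]
  · rw [← mul_assoc, s3, he1]
  · rw [← mul_assoc, s3, heG]
  · calc q * F * c * (e * e1) = q * F * (c * e * e1) := by noncomm_ring
      _ = 0 := by rw [ce, ce1, mul_zero]
  · have cG : c * G = e * G := by rw [hc, mul_assoc, sub_mul, heG]; simp
    have HFG : H * F' * G = G - G * (ui * q) := by
      calc H * F' * G = H * (1 - q) * F' * G := by rw [hHq]
        _ = G * ui * ((1 - q) * (1 - q)) * F' * G := by rw [hH]; noncomm_ring
        _ = G * ui * ((1 - q) * F' * G) := by rw [hqq]; noncomm_ring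
        _ = G * (ui * u) - G * (ui * q) := by rw [hT]; noncomm_ring
        _ = _ := by rw [hiu, mul_one]
    have eG : e * G = G * (ui * q) := by
      rw [he, sub_mul, HFG]; noncomm_ring
    calc q * F * c * (e * G) + q * e2 * (e2 * ui * q)
        = q * F * (c * e * G) + q * (e2 * e2) * (ui * q) := by noncomm_ring
      _ = q * (F * G) * (ui * q) + q * e2 * (ui * q) := by rw [ce, cG, eG, e2e2]; noncomm_ring
      _ = (q * ui) * q := by rw [hFG]; noncomm_ring
      _ = q := by rw [hqui, hq]

theorem isProjn_add {A : Type*} [CStarAlgebra A] {p q : A} (hp : IsProjn p) (hq : IsProjn q)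
    (h : p * q = 0) : IsProjn (p + q) := by
  have h' : q * p = 0 := by
    have := congrArg star h
    have hps : star p = p := hp.1
    have hqs : star q = q := hq.1
    simpa [hps, hqs] using this
  exact ⟨hp.1.add hq.1, by rw [mul_add, add_mul, add_mul, hp.2, hq.2, h, h']; simp⟩

end Helpers

/-- if `F ∈ MKΦ(A)` and `K ∈ F`, then `F + K ∈ MKΦ(A)` and
`index (F + K) = index F`. -/
theorem stmt_13 {A : Type*} [CStarAlgebra A] (Fc : FiniteTypeIdeal A) (F K f1 f2 : A)
    (hF : MKPhi Fc F f1 f2) (hK : K ∈ Fc.carrier) :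
    ∃ g1 g2 : A, MKPhi Fc (F + K) g1 g2 ∧ KEqList Fc.carrier [g1, f2] [f1, g2] := by
  obtain ⟨hD, hf1, hf2⟩ := hF
  obtain ⟨pf1, pf2, e1, e2, G, he1, he2, hfe1, hef1, hfe2, hef2, hFG, hGF, heG, hGe⟩ :=
    alg_of_decomp hD
  have neg_mem : ∀ {x : A}, x ∈ Fc.carrier → -x ∈ Fc.carrier := fun {x} hx => by
    have := Fc.mul_left_mem (-1) hx; simpa using this
  have me1 : e1 ∈ Fc.carrier := hfe1 ▸ Fc.mul_right_mem e1 hf1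
  have me2 : e2 ∈ Fc.carrier := hfe2 ▸ Fc.mul_right_mem e2 hf2
  have mx : e2 + -(K * G) ∈ Fc.carrier := Fc.add_mem me2 (neg_mem (Fc.mul_right_mem G hK))
  set x : A := e2 + -(K * G) with hx
  obtain ⟨q, mq, pq, hqx⟩ := Fc.approx_unit x mx 1 one_pos
  have hq : q * q = q := pq.2
  obtain ⟨U, hU⟩ := isUnit_one_sub_of_norm_lt_one hqx
  set u : A := ↑U with hu
  set ui : A := ↑U⁻¹ with huidef
  have hui : u * ui = 1 := Units.mul_inv U
  have hiu : ui * u = 1 := Units.inv_mul U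
  have hqu : q * u = q := by rw [hU, mul_sub, mul_sub, ← mul_assoc, hq]; simp
  have huF : u = (1 - q) * (F + K) * G + q := by
    have : (1 - q) * (F + K) * G + q = (1 - q) * (F * G + K * G) + q := by noncomm_ring
    rw [this, hFG, hU, hx]; noncomm_ring
  obtain ⟨H, hH⟩ : ∃ H, H = G * ui * (1 - q) := ⟨_, rfl⟩
  obtain ⟨e, he⟩ : ∃ e, e = 1 - H * (F + K) := ⟨_, rfl⟩
  obtain ⟨c, hc⟩ : ∃ c, c = e * (1 - e1) := ⟨_, rfl⟩
  obtain ⟨s1, s2, s3, s4, k1, k2, k3, k4, j1, j2, j3, j4, ce⟩ :=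
    core_ring he1 hq hFG hGF heG hGe huF hui hiu hqu hH he hc
  have hHq : H * q = 0 := by rw [hH, mul_assoc, sub_mul, hq]; simp
  -- membership of `e`
  have me : e ∈ Fc.carrier := by
    have h1u : ui * (x - q * x) = ui - 1 := by
      have : x - q * x = 1 - u := by rw [hU]; abel
      rw [this, mul_sub, hiu, mul_one]
    have mxq : x - q * x ∈ Fc.carrier := by
      rw [sub_eq_add_neg]; exact Fc.add_mem mx (neg_mem (Fc.mul_left_mem q mx))
    have : e = e1 + -(G * K) + -(G * (ui * (x - q * x)) * (F + K)) + G * ui * q * (F + K) := by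
      have e1' : e1 = 1 - G * F := by rw [hGF]; abel
      rw [h1u, he, hH, e1']; noncomm_ring
    rw [this]
    refine Fc.add_mem (Fc.add_mem (Fc.add_mem me1 (neg_mem (Fc.mul_left_mem _ hK))) (neg_mem ?_)) ?_
    · exact Fc.mul_right_mem _ (Fc.mul_left_mem _ (Fc.mul_left_mem _ mxq))
    · exact Fc.mul_right_mem _ (Fc.mul_left_mem _ mq)
  obtain ⟨g1, pg1, hge, heg⟩ := exists_projn_of_idem e s2
  have mg1 : g1 ∈ Fc.carrier := heg ▸ Fc.mul_right_mem g1 me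
  -- the second idempotent
  have hqe' : q * (1 - (F + K) * H) = 1 - (F + K) * H := by
    have h0 : (1 - q) * (1 - (F + K) * H) = 0 := by
      rw [mul_sub, ← mul_assoc, s1]; simp
    rw [sub_mul, one_mul, sub_eq_zero] at h0
    exact h0.symm
  have heq' : (1 - (F + K) * H) * q = q := by
    rw [sub_mul, mul_assoc, hHq]; simp
  have hD' : HasDiagDecomp (F + K) g1 q := by
    refine decomp_of_alg (G := H) (e1 := e) (e2 := 1 - (F + K) * H) s2 ?_ ?_ ?_ pg1 pq hge heg hqe' heq'
    · nth_rw 2 [← hqe']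
      rw [← mul_assoc, heq', hqe']
    · abel
    · rw [he]; abel
  refine ⟨g1, q, ⟨hD', mg1, mq⟩, ?_⟩
  obtain ⟨v, hv1, hv2, hv3⟩ := Fc.orth_exists f2 g1 hf2 mg1 pf2 pg1
  obtain ⟨w, hw1, hw2, hw3⟩ := Fc.orth_exists q f1 mq hf1 pq pf1
  obtain ⟨gv, vf, fv⟩ := partial_iso_facts pg1 pf2 hv1 hv2
  obtain ⟨fw, wq, qw⟩ := partial_iso_facts pf1 pq hw1 hw2
  have mvn0 : MvN (0 : A) 0 := ⟨0, by simp, by simp⟩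
  have mvnp : ∀ p : A, IsProjn p → MvN p p := fun p hp => by
    have hps : star p = p := hp.1
    exact ⟨p, by rw [hps, hp.2], by rw [hps, hp.2]⟩
  have ol0 : OrthSumList [(0 : A)] (0 + 0) := OrthSumList.cons mvn0 OrthSumList.nil (by simp)
  refine ⟨0, star v * v + (f2 + (0 + 0)), star w * w + (q + (0 + 0)), ⟨by simp [IsSelfAdjoint], by simp⟩,
    Fc.zero_mem, ?_, ?_, ?_⟩
  · exact OrthSumList.cons ⟨star v, by simp, by simpa using hv1⟩
      (OrthSumList.cons (mvnp _ pf2) ol0 (by simp)) (by simpa using hv2)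
  · exact OrthSumList.cons ⟨star w, by simp, by simpa using hw1⟩
      (OrthSumList.cons (mvnp _ pq) ol0 (by simp)) (by simpa using hw2)
  · simp only [add_zero]
    have h11 : v * (star v * e) = e := by rw [← mul_assoc, hv1, hge]
    have h12 : v * e2 = 0 := by rw [← hfe2, ← mul_assoc, vf, zero_mul]
    have h21 : f2 * (star v * e) = 0 := by rw [← mul_assoc, fv, zero_mul]
    have h33 : w * (star w * e1) = e1 := by rw [← mul_assoc, hw1, hfe1]
    have h43 : q * (star w * e1) = 0 := by rw [← mul_assoc, qw, zero_mul]
    have hcP : q * F * c * e = q * F * c := by rw [mul_assoc, ce]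
    have hYX := block_equiv (a1 := star v * e) (a2 := e2) (a3 := star w * e1) (a4 := q) (b1 := v)
      (b2 := f2) (b3 := w) (b4 := q) (x11 := e1) (x21 := q * F * c) (x22 := q * e2) (y11 := e * e1)
      (y12 := e * G) (y22 := e2 * ui * q) h11 hfe2 h12 h21 (by rw [mul_assoc, he1]) s4
      (by rw [mul_assoc, hq]) h33 hq wq h43 k1 k2 k3 k4
    have hXY := block_equiv' (a1 := star v * e) (a2 := e2) (a3 := star w * e1) (a4 := q) (b1 := v)
      (b2 := f2) (b3 := w) (b4 := q) (x11 := e1) (x21 := q * F * c) (x22 := q * e2) (y11 := e * e1)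
      (y12 := e * G) (y22 := e2 * ui * q) h11 hfe2 h12 h21 s3 hcP
      (by rw [mul_assoc, he2]) j1 j2 j3 j4
    refine mvN_of_alg _ _ _ _ hv3 hw3 (hYX.trans ?_) (hXY.trans ?_)
    · have : e * v = v := by rw [← gv, ← mul_assoc, heg]
      rw [mul_assoc (star v), s2, mul_assoc (star v), this, he2, hef2]
    · have : e1 * w = w := by rw [← fw, ← mul_assoc, hef1]
      rw [mul_assoc (star w), he1, mul_assoc (star w), this, hq, hq]
end
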